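/- arXiv:1502.00886 — 2 statements merged into one kernel-verified Lean document; each statement's English description precedes it below -/
import Mathlib

section
/- Theorem 2.1(i): Suppose the symmetric, measurable, uniformly elliptic coefficients a^{ij} on ℝ^d are independent of x', i.e. a^{ij}(x',x'') = a^{ij}(y',x'') for all x', y' ∈ ℝ^q and x'' ∈ ℝ^{d−q}. Let δ ∈ (0,1), let f : ℝ^d → ℝ satisfy [f]_{x',δ;ℝ^d} < ∞, and let u be a bounded classical solution of a^{ij}D_{ij}u = f in ℝ^d. Then there is a constant N depending only on d, q, ν, δ such that [u]_{x',2+δ;ℝ^d} ≤ N [f]_{x',δ;ℝ^d}, i.e. [D_i D_j u]_{x',δ;ℝ^d} ≤ N [f]_{x',δ;ℝ^d} for all 1 ≤ i, j ≤ q. -/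
open MeasureTheory Metric Set Filter

noncomputable section

/-- First-order partial derivative `D_i`. -/
def pd {d : ℕ} (i : Fin d) (v : EuclideanSpace ℝ (Fin d) → ℝ)
    (x : EuclideanSpace ℝ (Fin d)) : ℝ :=
  fderiv ℝ v x (EuclideanSpace.single i 1)

/-- Second-order partial derivative `D_i D_j`. -/
def pd2 {d : ℕ} (i j : Fin d) (v : EuclideanSpace ℝ (Fin d) → ℝ)
    (x : EuclideanSpace ℝ (Fin d)) : ℝ :=
  pd i (fun y => pd j v y) x

/-- Partial Hölder bound with respect to the first `q` coordinates:
`|g x - g y| ≤ K |x' - y'|^δ` whenever `x'' = y''` (note `dist x y = |x' - y'|` then). -/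
def PHolderX (d q : ℕ) (δ : ℝ) (Ω : Set (EuclideanSpace ℝ (Fin d)))
    (g : EuclideanSpace ℝ (Fin d) → ℝ) (K : ℝ) : Prop :=
  ∀ x ∈ Ω, ∀ y ∈ Ω, (∀ i : Fin d, q ≤ (i : ℕ) → x i = y i) →
    |g x - g y| ≤ K * dist x y ^ δ

/-- Full Hölder bound. -/
def HolderB {d : ℕ} (δ : ℝ) (Ω : Set (EuclideanSpace ℝ (Fin d)))
    (g : EuclideanSpace ℝ (Fin d) → ℝ) (K : ℝ) : Prop :=
  ∀ x ∈ Ω, ∀ y ∈ Ω, |g x - g y| ≤ K * dist x y ^ δ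

/-- Uniform ellipticity with constant `ν` (two-sided bound). -/
def UnifElliptic (d : ℕ) (ν : ℝ)
    (a : Fin d → Fin d → EuclideanSpace ℝ (Fin d) → ℝ) : Prop :=
  ∀ (x : EuclideanSpace ℝ (Fin d)) (ξ : Fin d → ℝ),
    ν * ∑ i, ξ i ^ 2 ≤ ∑ i, ∑ j, a i j x * ξ i * ξ j ∧
      ∑ i, ∑ j, a i j x * ξ i * ξ j ≤ ν⁻¹ * ∑ i, ξ i ^ 2

/-- Hilbert–Schmidt norm of the Hessian. -/
def hessNorm {d : ℕ} (v : EuclideanSpace ℝ (Fin d) → ℝ)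
    (x : EuclideanSpace ℝ (Fin d)) : ℝ :=
  Real.sqrt (∑ i, ∑ j, pd2 i j v x ^ 2)

/-- Euclidean norm of the gradient. -/
def gradNorm {d : ℕ} (v : EuclideanSpace ℝ (Fin d) → ℝ)
    (x : EuclideanSpace ℝ (Fin d)) : ℝ :=
  Real.sqrt (∑ i, pd i v x ^ 2)


section

variable {d : ℕ}

lemma second_test {f f' : ℝ → ℝ} {x₀ c : ℝ} (h : IsLocalMax f x₀)
    (h1 : ∀ᶠ x in nhds x₀, HasDerivAt f (f' x) x) (h2 : HasDerivAt f' c x₀) : c ≤ 0 := by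
  by_contra hc
  push Not at hc
  have e1 : deriv f =ᶠ[nhds x₀] f' := h1.mono fun x hx => hx.deriv
  have e2 : deriv (deriv f) x₀ = c := by rw [e1.deriv_eq, h2.deriv]
  have hmin : IsLocalMin f x₀ := isLocalMin_of_deriv_deriv_pos (by rw [e2]; exact hc)
    h.deriv_eq_zero h1.self_of_nhds.continuousAt
  have hcst : f =ᶠ[nhds x₀] fun _ => f x₀ := by
    filter_upwards [h, hmin] with x h1 h2 using le_antisymm h1 h2
  have : deriv f =ᶠ[nhds x₀] fun _ => 0 := by
    have := hcst.deriv
    simpa using this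
  rw [this.deriv_eq] at e2
  simp at e2
  linarith

/-- symmetric difference -/
def dl (p : EuclideanSpace ℝ (Fin d)) (v : EuclideanSpace ℝ (Fin d) → ℝ)
    (x : EuclideanSpace ℝ (Fin d)) : ℝ := v (x + p) - v (x - p)

lemma dl_comm (p p' : EuclideanSpace ℝ (Fin d)) (v : EuclideanSpace ℝ (Fin d) → ℝ) :
    dl p (dl p' v) = dl p' (dl p v) := by
  funext x
  simp only [dl]
  rw [show x + p + p' = x + p' + p by abel, show x + p - p' = x - p' + p by abel,
    show x - p + p' = x + p' - p by abel, show x - p - p' = x - p' - p by abel]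
  ring

lemma dl_contDiff {v : EuclideanSpace ℝ (Fin d) → ℝ} (hv : ContDiff ℝ 2 v)
    (p : EuclideanSpace ℝ (Fin d)) : ContDiff ℝ 2 (dl p v) := by
  unfold dl
  fun_prop

/-- Hessian as a bilinear map -/
def hs (v : EuclideanSpace ℝ (Fin d) → ℝ) (x : EuclideanSpace ℝ (Fin d)) :
    EuclideanSpace ℝ (Fin d) →L[ℝ] EuclideanSpace ℝ (Fin d) →L[ℝ] ℝ :=
  fderiv ℝ (fderiv ℝ v) x

lemma fd_differentiable {v : EuclideanSpace ℝ (Fin d) → ℝ} (hv : ContDiff ℝ 2 v) :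
    Differentiable ℝ (fderiv ℝ v) :=
  (hv.fderiv_right (m := 1) (by norm_num)).differentiable (by norm_num)

lemma hs_continuous {v : EuclideanSpace ℝ (Fin d) → ℝ} (hv : ContDiff ℝ 2 v) :
    Continuous (hs v) :=
  (hv.fderiv_right (m := 1) (by norm_num)).continuous_fderiv (by norm_num)

lemma pd2_eq {v : EuclideanSpace ℝ (Fin d) → ℝ} (hv : ContDiff ℝ 2 v) (i j : Fin d)
    (x : EuclideanSpace ℝ (Fin d)) :
    pd2 i j v x = hs v x (EuclideanSpace.single i 1) (EuclideanSpace.single j 1) := by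
  unfold pd2 pd hs
  have h := ((fd_differentiable hv) x).hasFDerivAt
  have := (h.clm_apply (hasFDerivAt_const (EuclideanSpace.single j (1 : ℝ)) x)).fderiv
  rw [this]
  simp

lemma fderiv_dl {v : EuclideanSpace ℝ (Fin d) → ℝ} (hv : Differentiable ℝ v)
    (p x : EuclideanSpace ℝ (Fin d)) :
    fderiv ℝ (dl p v) x = fderiv ℝ v (x + p) - fderiv ℝ v (x - p) := by
  have h1 : HasFDerivAt (fun y => v (y + p)) (fderiv ℝ v (x + p)) x := by
    have := (hv (x + p)).hasFDerivAt.comp x ((hasFDerivAt_id x).add_const p)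
    rw [ContinuousLinearMap.comp_id] at this
    exact this
  have h2 : HasFDerivAt (fun y => v (y - p)) (fderiv ℝ v (x - p)) x := by
    have := (hv (x - p)).hasFDerivAt.comp x ((hasFDerivAt_id x).sub_const p)
    rw [ContinuousLinearMap.comp_id] at this
    exact this
  exact (h1.sub h2).fderiv

lemma hs_dl {v : EuclideanSpace ℝ (Fin d) → ℝ} (hv : ContDiff ℝ 2 v)
    (p x : EuclideanSpace ℝ (Fin d)) :
    hs (dl p v) x = hs v (x + p) - hs v (x - p) := by
  have e : fderiv ℝ (dl p v) = fun y => fderiv ℝ v (y + p) - fderiv ℝ v (y - p) :=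
    funext fun y => fderiv_dl (hv.differentiable (by norm_num)) p y
  have hv' := fd_differentiable hv
  unfold hs
  rw [e]
  have h1 : HasFDerivAt (fun y => fderiv ℝ v (y + p)) (fderiv ℝ (fderiv ℝ v) (x + p)) x := by
    have := (hv' (x + p)).hasFDerivAt.comp x ((hasFDerivAt_id x).add_const p)
    rw [ContinuousLinearMap.comp_id] at this
    exact this
  have h2 : HasFDerivAt (fun y => fderiv ℝ v (y - p)) (fderiv ℝ (fderiv ℝ v) (x - p)) x := by
    have := (hv' (x - p)).hasFDerivAt.comp x ((hasFDerivAt_id x).sub_const p)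
    rw [ContinuousLinearMap.comp_id] at this
    exact this
  exact (h1.sub h2).fderiv

lemma line_deriv1 {v : EuclideanSpace ℝ (Fin d) → ℝ} (hv : ContDiff ℝ 2 v)
    (x ξ : EuclideanSpace ℝ (Fin d)) (t : ℝ) :
    HasDerivAt (fun t : ℝ => v (x + t • ξ)) (fderiv ℝ v (x + t • ξ) ξ) t := by
  have h := ((hv.differentiable (by norm_num)) (x + t • ξ)).hasFDerivAt
  have h2 : HasDerivAt (fun t : ℝ => x + t • ξ) ξ t := by
    simpa using ((hasDerivAt_id t).smul_const ξ).const_add x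
  exact h.comp_hasDerivAt t h2

lemma line_deriv2 {v : EuclideanSpace ℝ (Fin d) → ℝ} (hv : ContDiff ℝ 2 v)
    (x ξ : EuclideanSpace ℝ (Fin d)) (t : ℝ) :
    HasDerivAt (fun t : ℝ => fderiv ℝ v (x + t • ξ) ξ) (hs v (x + t • ξ) ξ ξ) t := by
  have h := ((fd_differentiable hv) (x + t • ξ)).hasFDerivAt
  have h2 : HasDerivAt (fun t : ℝ => x + t • ξ) ξ t := by
    simpa using ((hasDerivAt_id t).smul_const ξ).const_add x
  have h3 := h.comp_hasDerivAt t h2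
  have := h3.clm_apply (hasDerivAt_const t ξ)
  simpa [hs] using this

/-- x-direction test -/
lemma xdir {v : EuclideanSpace ℝ (Fin d) → ℝ} (hv : ContDiff ℝ 2 v)
    {x : EuclideanSpace ℝ (Fin d)} {ε : ℝ}
    (h : IsLocalMax (fun y => v y - ε * ‖y‖ ^ 2) x) (ξ : EuclideanSpace ℝ (Fin d)) :
    hs v x ξ ξ ≤ 2 * ε * ‖ξ‖ ^ 2 := by
  have hc : ContinuousAt (fun t : ℝ => x + t • ξ) 0 := by fun_prop
  have hm : IsLocalMax (fun t : ℝ => v (x + t • ξ) - ε * ‖x + t • ξ‖ ^ 2) 0 := by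
    have : Tendsto (fun t : ℝ => x + t • ξ) (nhds 0) (nhds x) := by
      simpa [ContinuousAt] using hc
    have := this.eventually h
    simpa [IsLocalMax, IsMaxFilter] using this
  have e : ∀ t : ℝ, ‖x + t • ξ‖ ^ 2 = ‖x‖ ^ 2 + 2 * (t * inner ℝ x ξ) + t ^ 2 * ‖ξ‖ ^ 2 := by
    intro t
    rw [norm_add_sq_real, inner_smul_right, norm_smul, mul_pow]
    simp
  simp only [e] at hm
  have h1 : ∀ t : ℝ, HasDerivAt (fun t : ℝ => v (x + t • ξ) -
      ε * (‖x‖ ^ 2 + 2 * (t * inner ℝ x ξ) + t ^ 2 * ‖ξ‖ ^ 2))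
      (fderiv ℝ v (x + t • ξ) ξ - ε * (2 * inner ℝ x ξ + 2 * t * ‖ξ‖ ^ 2)) t := by
    intro t
    refine (line_deriv1 hv x ξ t).sub ?_
    refine HasDerivAt.const_mul ε ?_
    have a1 : HasDerivAt (fun t : ℝ => ‖x‖ ^ 2 + 2 * (t * inner ℝ x ξ)) (2 * inner ℝ x ξ) t := by
      simpa using (((hasDerivAt_id t).mul_const (inner ℝ x ξ)).const_mul 2).const_add (‖x‖ ^ 2)
    have a2 : HasDerivAt (fun t : ℝ => t ^ 2 * ‖ξ‖ ^ 2) (2 * t * ‖ξ‖ ^ 2) t := by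
      simpa using (hasDerivAt_pow 2 t).mul_const (‖ξ‖ ^ 2)
    exact a1.add a2
  have h2 : HasDerivAt (fun t : ℝ => fderiv ℝ v (x + t • ξ) ξ -
      ε * (2 * inner ℝ x ξ + 2 * t * ‖ξ‖ ^ 2)) (hs v x ξ ξ - ε * (2 * ‖ξ‖ ^ 2)) 0 := by
    have := line_deriv2 hv x ξ 0
    simp only [zero_smul, add_zero] at this
    refine this.sub (HasDerivAt.const_mul ε ?_)
    simpa using (((hasDerivAt_id (0 : ℝ)).const_mul 2).mul_const (‖ξ‖ ^ 2)).const_add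
      (2 * inner ℝ x ξ)
  have := second_test hm (Eventually.of_forall h1) h2
  linarith

/-- s-direction test -/
lemma sdir {w : EuclideanSpace ℝ (Fin d) → ℝ} (hw : ContDiff ℝ 2 w)
    {x e : EuclideanSpace ℝ (Fin d)} {s c γ l κ R : ℝ} (hs0 : 0 < s)
    (h : IsLocalMax (fun s : ℝ => dl (s • e) w x -
      (c * s ^ γ + l * s + κ * (s * (R - s)))) s) :
    hs (dl (s • e) w) x e e ≤ -(c * (γ * (1 - γ)) * s ^ (γ - 2) + 2 * κ) := by
  have h1 : ∀ᶠ t in nhds s, HasDerivAt (fun s : ℝ => dl (s • e) w x -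
      (c * s ^ γ + l * s + κ * (s * (R - s))))
      ((fderiv ℝ w (x + t • e) e + fderiv ℝ w (x + t • (-e)) e) -
        (c * (γ * t ^ (γ - 1)) + l + κ * (R - 2 * t))) t := by
    filter_upwards [lt_mem_nhds hs0] with t ht
    have a1 := line_deriv1 hw x e t
    have a2 := line_deriv1 hw x (-e) t
    have a3 : HasDerivAt (fun s : ℝ => dl (s • e) w x)
        (fderiv ℝ w (x + t • e) e + fderiv ℝ w (x + t • (-e)) e) t := by
      have := a1.sub a2
      have ef : (fun s : ℝ => dl (s • e) w x) =
          (fun t => w (x + t • e)) - fun t => w (x + t • -e) := by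
        funext t
        simp [dl, sub_eq_add_neg]
      rw [ef]
      exact this.congr_deriv (by simp)
    refine a3.sub ?_
    have b1 : HasDerivAt (fun s : ℝ => c * s ^ γ) (c * (γ * t ^ (γ - 1))) t :=
      (Real.hasDerivAt_rpow_const (Or.inl ht.ne')).const_mul c
    have b2 : HasDerivAt (fun s : ℝ => l * s) l t := by
      simpa using (hasDerivAt_id t).const_mul l
    have b3 : HasDerivAt (fun s : ℝ => κ * (s * (R - s))) (κ * (R - 2 * t)) t := by
      have := ((hasDerivAt_id t).mul ((hasDerivAt_id t).const_sub R)).const_mul κ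
      refine this.congr_deriv ?_
      simp only [id]
      ring
    exact (b1.add b2).add b3
  have h2 : HasDerivAt (fun t : ℝ => (fderiv ℝ w (x + t • e) e + fderiv ℝ w (x + t • (-e)) e) -
        (c * (γ * t ^ (γ - 1)) + l + κ * (R - 2 * t)))
      (hs (dl (s • e) w) x e e - (c * (γ * ((γ - 1) * s ^ (γ - 2))) + κ * (-2))) s := by
    have a1 := line_deriv2 hw x e s
    have a2 := line_deriv2 hw x (-e) s
    have a3 : HasDerivAt (fun t : ℝ => fderiv ℝ w (x + t • e) e + fderiv ℝ w (x + t • (-e)) e)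
        (hs (dl (s • e) w) x e e) s := by
      have := a1.sub a2
      rw [hs_dl hw]
      have ef : (fun t : ℝ => fderiv ℝ w (x + t • e) e + fderiv ℝ w (x + t • (-e)) e) =
          (fun t => fderiv ℝ w (x + t • e) e) - fun t => fderiv ℝ w (x + t • -e) (-e) := by
        funext t
        simp
      rw [ef]
      exact this.congr_deriv (by simp [sub_eq_add_neg])
    refine a3.sub ?_
    have b1 : HasDerivAt (fun s : ℝ => c * (γ * s ^ (γ - 1)))
        (c * (γ * ((γ - 1) * s ^ (γ - 2)))) s := by
      have := ((Real.hasDerivAt_rpow_const (p := γ - 1) (Or.inl hs0.ne')).const_mul γ).const_mul c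
      rwa [show γ - 1 - 1 = γ - 2 by ring] at this
    have b3 : HasDerivAt (fun t : ℝ => κ * (R - 2 * t)) (κ * (-2)) s := by
      simpa using (((hasDerivAt_id s).const_mul 2).const_sub R).const_mul κ
    exact (b1.add_const l).add b3
  have := second_test h h1 h2
  linarith


lemma quad (H : EuclideanSpace ℝ (Fin d) →L[ℝ] EuclideanSpace ℝ (Fin d) →L[ℝ] ℝ)
    (c : EuclideanSpace ℝ (Fin d)) :
    H c c = ∑ i, ∑ j, c i * c j *
      H (EuclideanSpace.single i 1) (EuclideanSpace.single j 1) := by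
  have hc : c = ∑ i, c i • EuclideanSpace.single i (1 : ℝ) := by
    ext k
    simp [Finset.sum_apply, Pi.single_apply]
  have h1 : H c c = ∑ i, c i * H (EuclideanSpace.single i 1) c := by
    conv_lhs => rw [show H c = ∑ i, c i • H (EuclideanSpace.single i 1) by
      conv_lhs => rw [hc]
      simp]
    simp
  have h2 : ∀ i : Fin d, H (EuclideanSpace.single i 1) c =
      ∑ j, c j * H (EuclideanSpace.single i 1) (EuclideanSpace.single j 1) := by
    intro i
    conv_lhs => rw [hc]
    simp
  rw [h1]
  refine Finset.sum_congr rfl fun i _ => ?_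
  rw [h2, Finset.mul_sum]
  exact Finset.sum_congr rfl fun j _ => by ring

open scoped MatrixOrder in
lemma psd_pair (P : Fin d → Fin d → ℝ) (hsymm : ∀ i j, P i j = P j i)
    (hP : ∀ ξ : Fin d → ℝ, 0 ≤ ∑ i, ∑ j, P i j * ξ i * ξ j)
    (H : EuclideanSpace ℝ (Fin d) →L[ℝ] EuclideanSpace ℝ (Fin d) →L[ℝ] ℝ) (κ : ℝ)
    (hH : ∀ ξ, H ξ ξ ≤ κ * ‖ξ‖ ^ 2) :
    ∑ i, ∑ j, P i j * H (EuclideanSpace.single i 1) (EuclideanSpace.single j 1)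
      ≤ κ * ∑ i, P i i := by
  have hM : (Matrix.of P).PosSemidef := by
    refine Matrix.PosSemidef.of_dotProduct_mulVec_nonneg ?_ ?_
    · ext i j
      simp [Matrix.conjTranspose_apply, hsymm i j]
    · intro ξ
      refine (hP ξ).trans_eq ?_
      simp only [dotProduct, Matrix.mulVec, Finset.mul_sum, Matrix.of_apply]
      refine Finset.sum_congr rfl fun i _ => Finset.sum_congr rfl fun j _ => ?_
      simp
      ring
  obtain ⟨C, hC⟩ := CStarAlgebra.nonneg_iff_eq_star_mul_self.mp hM.nonneg
  have hPC : ∀ i j, P i j = ∑ k, C k i * C k j := by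
    intro i j
    have := congrFun (congrFun hC i) j
    simpa [Matrix.mul_apply, Matrix.star_apply] using this
  let c : Fin d → EuclideanSpace ℝ (Fin d) := fun k => WithLp.toLp 2 (C k)
  have e1 : ∑ i, ∑ j, P i j * H (EuclideanSpace.single i 1) (EuclideanSpace.single j 1)
      = ∑ k, H (c k) (c k) := by
    have : ∀ k, H (c k) (c k) = ∑ i, ∑ j, C k i * C k j *
      H (EuclideanSpace.single i 1) (EuclideanSpace.single j 1) := fun k => quad H (c k)
    simp_rw [this, hPC, Finset.sum_mul]
    rw [Finset.sum_comm]
    refine (Finset.sum_congr rfl fun i _ => Finset.sum_comm).trans ?_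
    rw [Finset.sum_comm]
    refine Finset.sum_congr rfl fun k _ => ?_
    rw [Finset.sum_comm]
  have e2 : ∑ i, P i i = ∑ k, ‖c k‖ ^ 2 := by
    simp_rw [EuclideanSpace.norm_sq_eq, hPC]
    rw [Finset.sum_comm]
    refine Finset.sum_congr rfl fun k _ => Finset.sum_congr rfl fun i _ => ?_
    simp [c, sq]
  rw [e1, e2, Finset.mul_sum]
  exact Finset.sum_le_sum fun k _ => hH _

lemma inner_sq_le (e : EuclideanSpace ℝ (Fin d)) (he : ‖e‖ = 1) (ξ : Fin d → ℝ) :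
    (∑ i, e i * ξ i) ^ 2 ≤ ∑ i, ξ i ^ 2 := by
  have h := Finset.sum_mul_sq_le_sq_mul_sq Finset.univ (fun i => e i) ξ
  have : ∑ i, e i ^ 2 = 1 := by
    have := EuclideanSpace.norm_sq_eq e
    simp only [Real.norm_eq_abs, sq_abs] at this
    rw [← this, he]; norm_num
  rwa [this, one_mul] at h

lemma la {ν : ℝ} (hν : 0 < ν) (A : Fin d → Fin d → ℝ) (hsymm : ∀ i j, A i j = A j i)
    (hA : ∀ ξ : Fin d → ℝ, ν * ∑ i, ξ i ^ 2 ≤ ∑ i, ∑ j, A i j * ξ i * ξ j ∧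
      ∑ i, ∑ j, A i j * ξ i * ξ j ≤ ν⁻¹ * ∑ i, ξ i ^ 2)
    (e : Fin 3 → EuclideanSpace ℝ (Fin d)) (he : ∀ k, ‖e k‖ = 1)
    (H : EuclideanSpace ℝ (Fin d) →L[ℝ] EuclideanSpace ℝ (Fin d) →L[ℝ] ℝ) (κ : ℝ) (hκ : 0 ≤ κ)
    (hH : ∀ ξ, H ξ ξ ≤ κ * ‖ξ‖ ^ 2) (b : Fin 3 → ℝ) (hb : ∀ k, H (e k) (e k) ≤ - b k) :
    ∑ i, ∑ j, A i j * H (EuclideanSpace.single i 1) (EuclideanSpace.single j 1)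
      ≤ κ * (d / ν) - ν / 3 * ∑ k, b k := by
  have hnn : ∀ ξ : Fin d → ℝ, ∑ i, ∑ j, (∑ k, e k i * e k j) * ξ i * ξ j
      = ∑ k, (∑ i, e k i * ξ i) ^ 2 := by
    intro ξ
    simp_rw [sq, Finset.sum_mul_sum, Finset.sum_mul]
    refine (Finset.sum_congr rfl fun i _ => Finset.sum_comm).trans ?_
    rw [Finset.sum_comm]
    refine Finset.sum_congr rfl fun k _ => Finset.sum_congr rfl fun i _ =>
      Finset.sum_congr rfl fun j _ => by ring
  have key := psd_pair (fun i j => A i j - ν / 3 * ∑ k, e k i * e k j) ?_ ?_ H κ hH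
  · have e1 : ∑ i, ∑ j, (A i j - ν / 3 * ∑ k, e k i * e k j) *
        H (EuclideanSpace.single i 1) (EuclideanSpace.single j 1) =
        ∑ i, ∑ j, A i j * H (EuclideanSpace.single i 1) (EuclideanSpace.single j 1)
        - ν / 3 * ∑ k, H (e k) (e k) := by
      have : ∑ k, H (e k) (e k) = ∑ i, ∑ j, (∑ k, e k i * e k j) *
        H (EuclideanSpace.single i 1) (EuclideanSpace.single j 1) := by
        simp_rw [fun k => quad H (e k), Finset.sum_mul]
        rw [Finset.sum_comm]
        refine Finset.sum_congr rfl fun i _ => ?_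
        rw [Finset.sum_comm]
      rw [this]
      simp_rw [sub_mul, Finset.sum_sub_distrib, mul_assoc, Finset.mul_sum]
    have e2 : ∑ i, (A i i - ν / 3 * ∑ k, e k i * e k i) ≤ d / ν := by
      calc ∑ i, (A i i - ν / 3 * ∑ k, e k i * e k i) ≤ ∑ i : Fin d, ν⁻¹ := by
            refine Finset.sum_le_sum fun i _ => ?_
            have h1 := (hA (Pi.single i 1)).2
            simp [Pi.single_apply] at h1
            have h2 : 0 ≤ ∑ k, e k i * e k i := Finset.sum_nonneg fun k _ => mul_self_nonneg _
            have : 0 ≤ ν / 3 * ∑ k, e k i * e k i := by positivity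
            linarith
        _ = d / ν := by simp [div_eq_mul_inv]
    rw [e1] at key
    have e3 : ∑ k, H (e k) (e k) ≤ - ∑ k, b k := by
      rw [← Finset.sum_neg_distrib]
      exact Finset.sum_le_sum fun k _ => hb k
    have e4 := mul_le_mul_of_nonneg_left e2 hκ
    have e5 := mul_le_mul_of_nonneg_left e3 (by positivity : 0 ≤ ν / 3)
    linarith
  · intro i j
    simp only [hsymm i j, mul_comm (e _ i)]
  · intro ξ
    have h1 := (hA ξ).1
    have h2 : ∑ k, (∑ i, e k i * ξ i) ^ 2 ≤ ∑ k : Fin 3, ∑ i, ξ i ^ 2 :=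
      Finset.sum_le_sum fun k _ => inner_sq_le (e k) (he k) ξ
    rw [← hnn] at h2
    simp only [Finset.sum_const, Finset.card_univ, Fintype.card_fin] at h2
    have e0 : ∑ i, ∑ j, (A i j - ν / 3 * ∑ k, e k i * e k j) * ξ i * ξ j =
      ∑ i, ∑ j, A i j * ξ i * ξ j - ν / 3 * ∑ i, ∑ j, (∑ k, e k i * e k j) * ξ i * ξ j := by
      simp_rw [sub_mul, Finset.sum_sub_distrib, mul_assoc, Finset.mul_sum]
    rw [e0]
    have := mul_le_mul_of_nonneg_left h2 (by positivity : 0 ≤ ν / 3)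
    simp only [nsmul_eq_mul, Nat.cast_ofNat] at this
    linarith

lemma norm_near {X F : Type*} [TopologicalSpace X] [NormedAddCommGroup F] {g : X → F}
    (hg : Continuous g) (x₀ : X) {η : ℝ} (hη : 0 < η) :
    ∀ᶠ x in nhds x₀, ‖g x - g x₀‖ < η := by
  have hc : Continuous fun x => ‖g x - g x₀‖ := (hg.sub continuous_const).norm
  refine hc.continuousAt.eventually_lt continuousAt_const ?_
  simpa using hη

lemma mp {ν : ℝ} (hν : 0 < ν) (a : Fin d → Fin d → EuclideanSpace ℝ (Fin d) → ℝ)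
    (hsymm : ∀ i j x, a i j x = a j i x) (hA : UnifElliptic d ν a)
    (e : Fin 3 → EuclideanSpace ℝ (Fin d)) (he : ∀ k, ‖e k‖ = 1)
    {φ : EuclideanSpace ℝ (Fin d) → ℝ} (hφ : ContDiff ℝ 2 φ) {m : ℝ}
    (hL : ∀ᵐ x ∂(volume : Measure (EuclideanSpace ℝ (Fin d))),
      -m ≤ ∑ i, ∑ j, a i j x * pd2 i j φ x)
    (x₀ : EuclideanSpace ℝ (Fin d)) (κ : ℝ) (hκ : 0 ≤ κ)
    (hH : ∀ ξ, hs φ x₀ ξ ξ ≤ κ * ‖ξ‖ ^ 2) (b : Fin 3 → ℝ)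
    (hb : ∀ k, hs φ x₀ (e k) (e k) ≤ - b k) :
    -m ≤ κ * (d / ν) - ν / 3 * ∑ k, b k := by
  have main : ∀ η : ℝ, 0 < η → -m ≤ κ * (d / ν) - ν / 3 * ∑ k, b k + η * (d / ν + ν) := by
    intro η hη
    have hd := MeasureTheory.Measure.dense_of_ae hL
    have hnear : ∀ᶠ x in nhds x₀, ‖hs φ x - hs φ x₀‖ < η := by
      exact norm_near (F := EuclideanSpace ℝ (Fin d) →L[ℝ] EuclideanSpace ℝ (Fin d) →L[ℝ] ℝ)
        (g := hs φ) (hs_continuous hφ) x₀ hη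
    obtain ⟨x, hx1, hx2⟩ := mem_closure_iff_frequently.1 (hd x₀) |>.and_eventually hnear |>.exists
    have hx1 : -m ≤ ∑ i, ∑ j, a i j x * pd2 i j φ x := hx1
    have hdiff : ∀ ξ, hs φ x ξ ξ ≤ hs φ x₀ ξ ξ + η * ‖ξ‖ ^ 2 := by
      intro ξ
      have h1 : ‖(hs φ x - hs φ x₀) ξ ξ‖ ≤ ‖hs φ x - hs φ x₀‖ * ‖ξ‖ * ‖ξ‖ :=
        ContinuousLinearMap.le_opNorm₂ _ _ _
      have h2 : ‖hs φ x - hs φ x₀‖ * ‖ξ‖ * ‖ξ‖ ≤ η * ‖ξ‖ * ‖ξ‖ := by gcongr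
      have h3 := (le_abs_self _).trans (h1.trans h2)
      simp only [sub_apply] at h3
      nlinarith
    have := la hν (fun i j => a i j x) (fun i j => hsymm i j x) (hA x) e he (hs φ x) (κ + η)
      (by positivity) (fun ξ => by nlinarith [hdiff ξ, hH ξ]) (fun k => b k - η)
      (fun k => by have := hdiff (e k); rw [he k] at this; linarith [hb k])
    simp_rw [pd2_eq hφ] at hx1
    refine (hx1.trans this).trans (le_of_eq ?_)
    simp [Finset.sum_sub_distrib]
    ring
  have hp : 0 < (d / ν + ν) := by positivity
  refine le_of_forall_pos_le_add fun t ht => ?_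
  have := main (t / (d / ν + ν)) (by positivity)
  rwa [div_mul_cancel₀ _ hp.ne'] at this


lemma dl_L {q : ℕ} {a : Fin d → Fin d → EuclideanSpace ℝ (Fin d) → ℝ}
    (ha : ∀ i j (x y : EuclideanSpace ℝ (Fin d)),
          (∀ k : Fin d, q ≤ (k : ℕ) → x k = y k) → a i j x = a i j y)
    {v : EuclideanSpace ℝ (Fin d) → ℝ} (hv : ContDiff ℝ 2 v)
    {p : EuclideanSpace ℝ (Fin d)} (hp : ∀ k : Fin d, q ≤ (k : ℕ) → p k = 0) :
    (fun x => ∑ i, ∑ j, a i j x * pd2 i j (dl p v) x) =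
      dl p (fun x => ∑ i, ∑ j, a i j x * pd2 i j v x) := by
  funext x
  simp only [dl]
  rw [← Finset.sum_sub_distrib]
  refine Finset.sum_congr rfl fun i _ => ?_
  rw [← Finset.sum_sub_distrib]
  refine Finset.sum_congr rfl fun j _ => ?_
  rw [ha i j (x + p) x (fun k hk => by simp [hp k hk]),
    ha i j (x - p) x (fun k hk => by simp [hp k hk])]
  have h1 := pd2_eq (dl_contDiff hv p) i j x
  rw [hs_dl hv] at h1
  rw [h1, pd2_eq hv, pd2_eq hv]
  simp only [sub_apply]
  ring

lemma dl_ae {f g : EuclideanSpace ℝ (Fin d) → ℝ} (h : f =ᵐ[volume] g)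
    (p : EuclideanSpace ℝ (Fin d)) : dl p f =ᵐ[volume] dl p g := by
  have h1 := (measurePreserving_add_right (volume : Measure (EuclideanSpace ℝ (Fin d))) p).quasiMeasurePreserving.ae h
  have h2 := (measurePreserving_sub_right (volume : Measure (EuclideanSpace ℝ (Fin d))) p).quasiMeasurePreserving.ae h
  filter_upwards [h1, h2] with x hx1 hx2
  simp only [dl, hx1, hx2]

lemma dl_bound {g : EuclideanSpace ℝ (Fin d) → ℝ} {B : ℝ} (h : ∀ x, |g x| ≤ B)
    (p x : EuclideanSpace ℝ (Fin d)) : |dl p g x| ≤ 2 * B := by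
  unfold dl
  have := abs_sub (g (x + p)) (g (x - p))
  linarith [h (x + p), h (x - p)]

lemma dl_holder {q : ℕ} {δ K s : ℝ} (hδ : δ ∈ Ioo (0 : ℝ) 1) (hK : 0 ≤ K) (hs0 : 0 ≤ s)
    {f : EuclideanSpace ℝ (Fin d) → ℝ} (hf : PHolderX d q δ univ f K)
    {e : EuclideanSpace ℝ (Fin d)} (he : ‖e‖ = 1) (heq : ∀ k : Fin d, q ≤ (k : ℕ) → e k = 0)
    (x : EuclideanSpace ℝ (Fin d)) : |dl (s • e) f x| ≤ 2 * K * s ^ δ := by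
  have h := hf (x + s • e) (mem_univ _) (x - s • e) (mem_univ _)
    (fun k hk => by simp [heq k hk])
  have hdist : dist (x + s • e) (x - s • e) = 2 * s := by
    rw [dist_eq_norm, show x + s • e - (x - s • e) = (2 * s) • e by module, norm_smul, he]
    simp [abs_of_nonneg hs0]
  rw [hdist, Real.mul_rpow (by norm_num) hs0] at h
  have h2 : (2 : ℝ) ^ δ ≤ 2 := by
    conv_rhs => rw [← Real.rpow_one 2]
    exact Real.rpow_le_rpow_of_exponent_le (by norm_num) hδ.2.le
  refine h.trans ?_
  have : 0 ≤ s ^ δ := Real.rpow_nonneg hs0 _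
  have := mul_le_mul_of_nonneg_right h2 (mul_nonneg hK this)
  linarith

/-- The three smallest-step comparison of the barrier. -/
lemma barrier_ge {γ δ s t r : ℝ} (hγ : γ = (2 + δ) / 3) (hδ : 0 < δ) (hs : 0 < s) (hst : s ≤ t)
    (hsr : s ≤ r) : s ^ δ ≤ (t * r) ^ γ * s ^ (γ - 2) := by
  have h1 : (s * s) ^ γ ≤ (t * r) ^ γ := by
    apply Real.rpow_le_rpow (by positivity) (by nlinarith) (by rw [hγ]; linarith)
  have h2 : s ^ δ = (s * s) ^ γ * s ^ (γ - 2) := by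
    rw [Real.mul_rpow hs.le hs.le, ← Real.rpow_add hs, ← Real.rpow_add hs]
    congr 1
    rw [hγ]; ring
  rw [h2]
  exact mul_le_mul_of_nonneg_right h1 (Real.rpow_nonneg hs.le _)

lemma key_R {q : ℕ} {ν δ γ K M C R ε : ℝ} (hν : ν ∈ Ioc (0 : ℝ) 1) (hδ : δ ∈ Ioo (0 : ℝ) 1)
    (hγ : γ = (2 + δ) / 3) (hC : C = 24 / (ν * (γ * (1 - γ))))
    {a : Fin d → Fin d → EuclideanSpace ℝ (Fin d) → ℝ}
    {u f : EuclideanSpace ℝ (Fin d) → ℝ}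
    (hsymm : ∀ i j x, a i j x = a j i x) (hA : UnifElliptic d ν a)
    (ha : ∀ i j (x y : EuclideanSpace ℝ (Fin d)),
          (∀ k : Fin d, q ≤ (k : ℕ) → x k = y k) → a i j x = a i j y)
    (hu : ContDiff ℝ 2 u) (hM : ∀ x, |u x| ≤ M)
    (hL : ∀ᵐ x ∂(volume : Measure (EuclideanSpace ℝ (Fin d))),
          ∑ i, ∑ j, a i j x * pd2 i j u x = f x)
    (hK : 0 ≤ K) (hf : PHolderX d q δ univ f K)
    {e₁ e₂ e₃ : EuclideanSpace ℝ (Fin d)} (he1 : ‖e₁‖ = 1) (he2 : ‖e₂‖ = 1) (he3 : ‖e₃‖ = 1)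
    (hq1 : ∀ k : Fin d, q ≤ (k : ℕ) → e₁ k = 0) (hq2 : ∀ k : Fin d, q ≤ (k : ℕ) → e₂ k = 0)
    (hq3 : ∀ k : Fin d, q ≤ (k : ℕ) → e₃ k = 0)
    (hε : 0 < ε) (x : EuclideanSpace ℝ (Fin d)) {s₁ s₂ s₃ : ℝ}
    (h1 : s₁ ∈ Icc 0 R) (h2 : s₂ ∈ Icc 0 R) (h3 : s₃ ∈ Icc 0 R) (hR : 0 < R) :
    dl (s₁ • e₁) (dl (s₂ • e₂) (dl (s₃ • e₃) u)) x ≤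
      C * K * (s₁ * s₂ * s₃) ^ γ + 8 * M / R * (s₁ + s₂ + s₃) +
      ε * (‖x‖ ^ 2 + (d / ν ^ 2 + 1) * (s₁ * (R - s₁) + s₂ * (R - s₂) + s₃ * (R - s₃))) := by
  obtain ⟨hν0, hν1⟩ := hν
  have hγ0 : 0 < γ := by rw [hγ]; linarith [hδ.1]
  have hγ1 : γ < 1 := by rw [hγ]; linarith [hδ.2]
  have hγγ : 0 < γ * (1 - γ) := mul_pos hγ0 (by linarith)
  have hC0 : 0 < C := by rw [hC]; positivity
  have hM0 : 0 ≤ M := (abs_nonneg _).trans (hM 0)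
  set A : ℝ := d / ν ^ 2 + 1 with hAdef
  have hA0 : 0 < A := by positivity
  by_contra hcon
  push Not at hcon
  -- the function to be maximised
  let Ψ : EuclideanSpace ℝ (Fin d) × ℝ × ℝ × ℝ → ℝ := fun z =>
    dl (z.2.1 • e₁) (dl (z.2.2.1 • e₂) (dl (z.2.2.2 • e₃) u)) z.1 -
      (C * K * (z.2.1 * z.2.2.1 * z.2.2.2) ^ γ + 8 * M / R * (z.2.1 + z.2.2.1 + z.2.2.2) +
      ε * (‖z.1‖ ^ 2 + A * (z.2.1 * (R - z.2.1) + z.2.2.1 * (R - z.2.2.1)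
        + z.2.2.2 * (R - z.2.2.2))))
  have hΨc : Continuous Ψ := by
    have huc : Continuous u := hu.continuous
    have hr : Continuous fun z : EuclideanSpace ℝ (Fin d) × ℝ × ℝ × ℝ =>
        (z.2.1 * z.2.2.1 * z.2.2.2) ^ γ :=
      Continuous.rpow_const (by fun_prop) fun _ => Or.inr hγ0.le
    simp only [Ψ, dl]
    fun_prop
  obtain ⟨ρ, hρx, hρ⟩ : ∃ ρ : ℝ, ‖x‖ ≤ ρ ∧ 8 * M ≤ ε * ρ ^ 2 := by
    refine ⟨max ‖x‖ (max 1 (8 * M / ε)), le_max_left _ _, ?_⟩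
    set ρ := max ‖x‖ (max 1 (8 * M / ε))
    have r1 : 1 ≤ ρ := (le_max_left _ _).trans (le_max_right _ _)
    have r2 : 8 * M / ε ≤ ρ := (le_max_right _ _).trans (le_max_right _ _)
    rw [div_le_iff₀ hε] at r2
    nlinarith
  let S : Set (EuclideanSpace ℝ (Fin d) × ℝ × ℝ × ℝ) :=
    closedBall 0 ρ ×ˢ Icc 0 R ×ˢ Icc 0 R ×ˢ Icc 0 R
  have hS : IsCompact S :=
    (isCompact_closedBall 0 ρ).prod (isCompact_Icc.prod (isCompact_Icc.prod isCompact_Icc))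
  have hxS : (x, s₁, s₂, s₃) ∈ S := ⟨by simpa using hρx, h1, h2, h3⟩
  obtain ⟨z, hzS, hzmax⟩ := hS.exists_isMaxOn ⟨_, hxS⟩ hΨc.continuousOn
  have hpos : 0 < Ψ z := by
    refine lt_of_lt_of_le ?_ (hzmax hxS)
    simp only [Ψ]
    linarith
  obtain ⟨x₀, t₁, t₂, t₃⟩ := z
  obtain ⟨hx0, ht1, ht2, ht3⟩ := hzS
  simp only [mem_closedBall, dist_zero_right] at hx0
  have ht1 : t₁ ∈ Icc 0 R := ht1
  have ht2 : t₂ ∈ Icc 0 R := ht2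
  have ht3 : t₃ ∈ Icc 0 R := ht3
  have hφ8 : ∀ p₁ p₂ p₃ y, dl p₁ (dl p₂ (dl p₃ u)) y ≤ 8 * M := by
    intro p₁ p₂ p₃ y
    have := dl_bound (dl_bound (dl_bound hM p₃) p₂) p₁ y
    linarith [le_abs_self (dl p₁ (dl p₂ (dl p₃ u)) y)]
  have hφ := hφ8 (t₁ • e₁) (t₂ • e₂) (t₃ • e₃) x₀
  -- all terms are nonnegative
  have n1 : 0 ≤ C * K * (t₁ * t₂ * t₃) ^ γ := by
    have : 0 ≤ t₁ * t₂ * t₃ := mul_nonneg (mul_nonneg ht1.1 ht2.1) ht3.1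
    positivity
  have n2 : ∀ t ∈ Icc (0 : ℝ) R, 0 ≤ 8 * M / R * t := fun t ht => by
    have := ht.1
    positivity
  have n3 : ∀ t ∈ Icc (0 : ℝ) R, 0 ≤ ε * (A * (t * (R - t))) := fun t ht =>
    mul_nonneg hε.le (mul_nonneg hA0.le (mul_nonneg ht.1 (by linarith [ht.2])))
  have n4 : 0 ≤ ε * ‖x₀‖ ^ 2 := by positivity
  have m1 := n2 t₁ ht1
  have m2 := n2 t₂ ht2
  have m3 := n2 t₃ ht3
  have l1 := n3 t₁ ht1
  have l2 := n3 t₂ ht2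
  have l3 := n3 t₃ ht3
  have hRM : 8 * M / R * R = 8 * M := div_mul_cancel₀ _ hR.ne'
  have hpos' : 0 < dl (t₁ • e₁) (dl (t₂ • e₂) (dl (t₃ • e₃) u)) x₀ -
      (C * K * (t₁ * t₂ * t₃) ^ γ + 8 * M / R * (t₁ + t₂ + t₃) +
      ε * (‖x₀‖ ^ 2 + A * (t₁ * (R - t₁) + t₂ * (R - t₂) + t₃ * (R - t₃)))) := hpos
  have z0 : ∀ v : EuclideanSpace ℝ (Fin d) → ℝ, dl 0 v = fun _ => 0 := by
    intro v; funext y; simp [dl]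
  have zz : ∀ p : EuclideanSpace ℝ (Fin d), dl p (fun _ => (0 : ℝ)) = fun _ => 0 := by
    intro v; funext y; simp [dl]
  have p1 : 0 < t₁ := by
    rcases ht1.1.eq_or_lt with h | h
    · rw [← h, zero_smul, z0] at hpos'
      rw [← h] at n1 m1 l1
      linarith
    · exact h
  have p2 : 0 < t₂ := by
    rcases ht2.1.eq_or_lt with h | h
    · rw [← h, zero_smul, z0, zz] at hpos'
      rw [← h] at n1 m2 l2
      linarith
    · exact h
  have p3 : 0 < t₃ := by
    rcases ht3.1.eq_or_lt with h | h
    · rw [← h, zero_smul, z0, zz, zz] at hpos'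
      rw [← h] at n1 m3 l3
      linarith
    · exact h
  have r1 : t₁ < R := by
    rcases ht1.2.eq_or_lt with h | h
    · rw [h] at hpos' n1 hφ m1 l1
      linarith
    · exact h
  have r2 : t₂ < R := by
    rcases ht2.2.eq_or_lt with h | h
    · rw [h] at hpos' n1 hφ m2 l2
      linarith
    · exact h
  have r3 : t₃ < R := by
    rcases ht3.2.eq_or_lt with h | h
    · rw [h] at hpos' n1 hφ m3 l3
      linarith
    · exact h
  have rx : ‖x₀‖ < ρ := by
    rcases hx0.eq_or_lt with h | h
    · rw [h] at hpos' n4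
      linarith
    · exact h
  have hloc : IsLocalMax Ψ (x₀, t₁, t₂, t₃) := by
    refine hzmax.isLocalMax ?_
    refine prod_mem_nhds ?_ (prod_mem_nhds (Icc_mem_nhds p1 r1)
      (prod_mem_nhds (Icc_mem_nhds p2 r2) (Icc_mem_nhds p3 r3)))
    exact closedBall_mem_nhds_of_mem (by simpa using rx)
  set φ := dl (t₁ • e₁) (dl (t₂ • e₂) (dl (t₃ • e₃) u)) with hφdef
  have hφ2 : ContDiff ℝ 2 φ := dl_contDiff (dl_contDiff (dl_contDiff hu _) _) _
  -- x-directions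
  have hX : ∀ ξ, hs φ x₀ ξ ξ ≤ 2 * ε * ‖ξ‖ ^ 2 := by
    refine xdir hφ2 ?_
    have ht : Tendsto (fun y : EuclideanSpace ℝ (Fin d) => (y, t₁, t₂, t₃)) (nhds x₀)
        (nhds (x₀, t₁, t₂, t₃)) :=
      Continuous.tendsto (by fun_prop) x₀
    refine (ht.eventually hloc).mono fun y hy => ?_
    simp only [Ψ, ← hφdef] at hy
    linarith
  -- s-directions
  have hb1 : hs φ x₀ e₁ e₁ ≤
      -(C * K * (t₂ * t₃) ^ γ * (γ * (1 - γ)) * t₁ ^ (γ - 2) + 2 * (ε * A)) := by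
    refine sdir (l := 8 * M / R) (R := R) (dl_contDiff (dl_contDiff hu _) _) p1 ?_
    have ht : Tendsto (fun t : ℝ => (x₀, t, t₂, t₃)) (nhds t₁) (nhds (x₀, t₁, t₂, t₃)) :=
      Continuous.tendsto (by fun_prop) t₁
    filter_upwards [ht.eventually hloc, lt_mem_nhds p1] with t hy ht0
    simp only [Ψ] at hy
    rw [show t * t₂ * t₃ = (t₂ * t₃) * t by ring, show t₁ * t₂ * t₃ = (t₂ * t₃) * t₁ by ring,
      Real.mul_rpow (by positivity) ht0.le, Real.mul_rpow (by positivity) p1.le] at hy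
    linarith
  have hφ' : φ = dl (t₂ • e₂) (dl (t₁ • e₁) (dl (t₃ • e₃) u)) := by rw [hφdef, dl_comm]
  have hφ'' : φ = dl (t₃ • e₃) (dl (t₁ • e₁) (dl (t₂ • e₂) u)) := by
    rw [hφdef, dl_comm (t₂ • e₂), dl_comm (t₁ • e₁)]
  have hb2 : hs φ x₀ e₂ e₂ ≤
      -(C * K * (t₁ * t₃) ^ γ * (γ * (1 - γ)) * t₂ ^ (γ - 2) + 2 * (ε * A)) := by
    rw [hφ']
    refine sdir (l := 8 * M / R) (R := R) (dl_contDiff (dl_contDiff hu _) _) p2 ?_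
    have ht : Tendsto (fun t : ℝ => (x₀, t₁, t, t₃)) (nhds t₂) (nhds (x₀, t₁, t₂, t₃)) :=
      Continuous.tendsto (by fun_prop) t₂
    filter_upwards [ht.eventually hloc, lt_mem_nhds p2] with t hy ht0
    simp only [Ψ] at hy
    have c1 : ∀ t : ℝ, dl (t₁ • e₁) (dl (t • e₂) (dl (t₃ • e₃) u)) =
        dl (t • e₂) (dl (t₁ • e₁) (dl (t₃ • e₃) u)) := fun t => dl_comm _ _ _
    rw [show t₁ * t * t₃ = (t₁ * t₃) * t by ring, show t₁ * t₂ * t₃ = (t₁ * t₃) * t₂ by ring,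
      Real.mul_rpow (by positivity) ht0.le, Real.mul_rpow (by positivity) p2.le,
      c1, c1] at hy
    linarith
  have hb3 : hs φ x₀ e₃ e₃ ≤
      -(C * K * (t₁ * t₂) ^ γ * (γ * (1 - γ)) * t₃ ^ (γ - 2) + 2 * (ε * A)) := by
    rw [hφ'']
    refine sdir (l := 8 * M / R) (R := R) (dl_contDiff (dl_contDiff hu _) _) p3 ?_
    have ht : Tendsto (fun t : ℝ => (x₀, t₁, t₂, t)) (nhds t₃) (nhds (x₀, t₁, t₂, t₃)) :=
      Continuous.tendsto (by fun_prop) t₃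
    filter_upwards [ht.eventually hloc, lt_mem_nhds p3] with t hy ht0
    simp only [Ψ] at hy
    have c1 : ∀ t : ℝ, dl (t₁ • e₁) (dl (t₂ • e₂) (dl (t • e₃) u)) =
        dl (t • e₃) (dl (t₁ • e₁) (dl (t₂ • e₂) u)) := fun t => by
      rw [dl_comm (t₂ • e₂), dl_comm (t₁ • e₁)]
    rw [Real.mul_rpow (by positivity) ht0.le, Real.mul_rpow (by positivity) p3.le, c1, c1] at hy
    linarith
  -- the equation
  have hsm : ∀ {t : ℝ} {e : EuclideanSpace ℝ (Fin d)}, (∀ k : Fin d, q ≤ (k : ℕ) → e k = 0) →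
      ∀ k : Fin d, q ≤ (k : ℕ) → (t • e) k = 0 := fun h k hk => by simp [h k hk]
  have hLφ : (fun x => ∑ i, ∑ j, a i j x * pd2 i j φ x) =ᵐ[volume]
      dl (t₁ • e₁) (dl (t₂ • e₂) (dl (t₃ • e₃) f)) := by
    rw [hφdef, dl_L ha (dl_contDiff (dl_contDiff hu _) _) (hsm hq1),
      dl_L ha (dl_contDiff hu _) (hsm hq2), dl_L ha hu (hsm hq3)]
    exact dl_ae (dl_ae (dl_ae hL _) _) _
  have hf' : ∀ x, |dl (t₁ • e₁) (dl (t₂ • e₂) (dl (t₃ • e₃) f)) x| ≤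
      8 * K * (min t₁ (min t₂ t₃)) ^ δ := by
    intro x
    rcases min_choice t₂ t₃ with h | h
    · rw [h]
      rcases min_choice t₁ t₂ with h | h
      · rw [h, dl_comm (t₁ • e₁), dl_comm (t₁ • e₁)]
        have := dl_bound (dl_bound (dl_holder hδ hK p1.le hf he1 hq1) (t₃ • e₃)) (t₂ • e₂) x
        linarith
      · rw [h, dl_comm (t₂ • e₂)]
        have := dl_bound (dl_bound (dl_holder hδ hK p2.le hf he2 hq2) (t₃ • e₃)) (t₁ • e₁) x
        linarith
    · rw [h]
      rcases min_choice t₁ t₃ with h | h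
      · rw [h, dl_comm (t₁ • e₁), dl_comm (t₁ • e₁)]
        have := dl_bound (dl_bound (dl_holder hδ hK p1.le hf he1 hq1) (t₃ • e₃)) (t₂ • e₂) x
        linarith
      · rw [h]
        have := dl_bound (dl_bound (dl_holder hδ hK p3.le hf he3 hq3) (t₂ • e₂)) (t₁ • e₁) x
        linarith
  have hfin := mp hν0 a hsymm hA ![e₁, e₂, e₃]
    (by intro k; fin_cases k <;> simp [he1, he2, he3]) hφ2
    (m := 8 * K * (min t₁ (min t₂ t₃)) ^ δ)
    (by filter_upwards [hLφ] with y hy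
        rw [hy]
        exact (abs_le.1 (hf' y)).1) x₀ (2 * ε) (by positivity) hX
    ![C * K * (t₂ * t₃) ^ γ * (γ * (1 - γ)) * t₁ ^ (γ - 2) + 2 * (ε * A),
      C * K * (t₁ * t₃) ^ γ * (γ * (1 - γ)) * t₂ ^ (γ - 2) + 2 * (ε * A),
      C * K * (t₁ * t₂) ^ γ * (γ * (1 - γ)) * t₃ ^ (γ - 2) + 2 * (ε * A)]
    (by intro k
        fin_cases k
        · exact hb1
        · exact hb2
        · exact hb3)
  simp only [Fin.sum_univ_three, Matrix.cons_val_zero, Matrix.cons_val_one, Matrix.cons_val] at hfin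
  set b₁ := (t₂ * t₃) ^ γ * t₁ ^ (γ - 2) with hb₁
  set b₂ := (t₁ * t₃) ^ γ * t₂ ^ (γ - 2) with hb₂
  set b₃ := (t₁ * t₂) ^ γ * t₃ ^ (γ - 2) with hb₃
  have q1 : 0 ≤ b₁ := by positivity
  have q2 : 0 ≤ b₂ := by positivity
  have q3 : 0 ≤ b₃ := by positivity
  have hmin : (min t₁ (min t₂ t₃)) ^ δ ≤ b₁ + b₂ + b₃ := by
    rcases le_total t₁ t₂ with h12 | h12 <;> rcases le_total t₁ t₃ with h13 | h13 <;>
      rcases le_total t₂ t₃ with h23 | h23 <;> simp only [h12, h13, h23, min_eq_left, min_eq_right]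
    · linarith [barrier_ge hγ hδ.1 p1 h12 h13]
    · linarith [barrier_ge hγ hδ.1 p1 h12 h13]
    · linarith [barrier_ge hγ hδ.1 p1 h12 (h12.trans h23)]
    · linarith [barrier_ge hγ hδ.1 p3 h13 h23]
    · linarith [barrier_ge hγ hδ.1 p2 h12 h23]
    · linarith [barrier_ge hγ hδ.1 p1 (h13.trans h23) h13]
    · linarith [barrier_ge hγ hδ.1 p2 h12 h23]
    · linarith [barrier_ge hγ hδ.1 p3 h13 h23]
  have hCeq : C * (γ * (1 - γ)) * (ν / 3) = 8 := by
    have h1γ : 1 - γ ≠ 0 := (by linarith : (0:ℝ) < 1 - γ).ne'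
    rw [hC]
    field_simp
    norm_num
  have hAeq : A * ν = d / ν + ν := by
    rw [hAdef]
    field_simp
  have hrw : 2 * ε * (d / ν) - ν / 3 * (C * K * (t₂ * t₃) ^ γ * (γ * (1 - γ)) * t₁ ^ (γ - 2) + 2 * (ε * A) +
      (C * K * (t₁ * t₃) ^ γ * (γ * (1 - γ)) * t₂ ^ (γ - 2) + 2 * (ε * A)) +
      (C * K * (t₁ * t₂) ^ γ * (γ * (1 - γ)) * t₃ ^ (γ - 2) + 2 * (ε * A)))
      = - (C * (γ * (1 - γ)) * (ν / 3)) * K * (b₁ + b₂ + b₃) + 2 * ε * (d / ν - A * ν) := by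
    rw [hb₁, hb₂, hb₃]
    ring
  rw [hrw, hCeq, hAeq] at hfin
  have h8 := mul_le_mul_of_nonneg_left hmin (by positivity : 0 ≤ 8 * K)
  have : 0 < ε * ν := by positivity
  linarith


/-- the key triple difference bound -/
def KB (d q : ℕ) (γ c : ℝ) (u : EuclideanSpace ℝ (Fin d) → ℝ) : Prop :=
  ∀ e₁ e₂ e₃ : EuclideanSpace ℝ (Fin d), ‖e₁‖ = 1 → ‖e₂‖ = 1 → ‖e₃‖ = 1 →
    (∀ k : Fin d, q ≤ (k : ℕ) → e₁ k = 0) → (∀ k : Fin d, q ≤ (k : ℕ) → e₂ k = 0) →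
    (∀ k : Fin d, q ≤ (k : ℕ) → e₃ k = 0) →
    ∀ s₁ s₂ s₃ : ℝ, 0 ≤ s₁ → 0 ≤ s₂ → 0 ≤ s₃ → ∀ x,
      |dl (s₁ • e₁) (dl (s₂ • e₂) (dl (s₃ • e₃) u)) x| ≤ c * (s₁ * s₂ * s₃) ^ γ

lemma key {q : ℕ} {ν δ γ K M C : ℝ} (hν : ν ∈ Ioc (0 : ℝ) 1) (hδ : δ ∈ Ioo (0 : ℝ) 1)
    (hγ : γ = (2 + δ) / 3) (hC : C = 24 / (ν * (γ * (1 - γ))))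
    {a : Fin d → Fin d → EuclideanSpace ℝ (Fin d) → ℝ}
    {u f : EuclideanSpace ℝ (Fin d) → ℝ}
    (hsymm : ∀ i j x, a i j x = a j i x) (hA : UnifElliptic d ν a)
    (ha : ∀ i j (x y : EuclideanSpace ℝ (Fin d)),
          (∀ k : Fin d, q ≤ (k : ℕ) → x k = y k) → a i j x = a i j y)
    (hu : ContDiff ℝ 2 u) (hM : ∀ x, |u x| ≤ M)
    (hL : ∀ᵐ x ∂(volume : Measure (EuclideanSpace ℝ (Fin d))),
          ∑ i, ∑ j, a i j x * pd2 i j u x = f x)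
    (hK : 0 ≤ K) (hf : PHolderX d q δ univ f K) : KB d q γ (C * K) u := by
  have main : ∀ e₁ e₂ e₃ : EuclideanSpace ℝ (Fin d), ‖e₁‖ = 1 → ‖e₂‖ = 1 → ‖e₃‖ = 1 →
    (∀ k : Fin d, q ≤ (k : ℕ) → e₁ k = 0) → (∀ k : Fin d, q ≤ (k : ℕ) → e₂ k = 0) →
    (∀ k : Fin d, q ≤ (k : ℕ) → e₃ k = 0) →
    ∀ s₁ s₂ s₃ : ℝ, 0 ≤ s₁ → 0 ≤ s₂ → 0 ≤ s₃ → ∀ x,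
      dl (s₁ • e₁) (dl (s₂ • e₂) (dl (s₃ • e₃) u)) x ≤ C * K * (s₁ * s₂ * s₃) ^ γ := by
    intro e₁ e₂ e₃ he1 he2 he3 hq1 hq2 hq3 s₁ s₂ s₃ h1 h2 h3 x
    have step : ∀ R : ℝ, 0 < R → s₁ ≤ R → s₂ ≤ R → s₃ ≤ R →
        dl (s₁ • e₁) (dl (s₂ • e₂) (dl (s₃ • e₃) u)) x ≤
          C * K * (s₁ * s₂ * s₃) ^ γ + 8 * M * (s₁ + s₂ + s₃) * R⁻¹ := by
      intro R hR r1 r2 r3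
      have hb : ∀ ε : ℝ, 0 < ε → _ := fun ε hε => key_R hν hδ hγ hC hsymm hA ha hu hM hL hK hf
        he1 he2 he3 hq1 hq2 hq3 hε x ⟨h1, r1⟩ ⟨h2, r2⟩ ⟨h3, r3⟩ hR
      refine le_of_forall_pos_le_add fun η hη => ?_
      set B := ‖x‖ ^ 2 + (d / ν ^ 2 + 1) * (s₁ * (R - s₁) + s₂ * (R - s₂) + s₃ * (R - s₃)) with hB
      have hB0 : 0 < |B| + 1 := by positivity
      have := hb (η / (|B| + 1)) (by positivity)
      have h4 : η / (|B| + 1) * B ≤ η := by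
        rw [div_mul_eq_mul_div, div_le_iff₀ hB0]
        nlinarith [le_abs_self B]
      have h5 : 8 * M / R * (s₁ + s₂ + s₃) = 8 * M * (s₁ + s₂ + s₃) * R⁻¹ := by
        rw [div_eq_mul_inv]; ring
      linarith
    have lim : Tendsto (fun R : ℝ => C * K * (s₁ * s₂ * s₃) ^ γ + 8 * M * (s₁ + s₂ + s₃) * R⁻¹)
        atTop (nhds (C * K * (s₁ * s₂ * s₃) ^ γ + 8 * M * (s₁ + s₂ + s₃) * 0)) :=
      (tendsto_inv_atTop_zero.const_mul _).const_add _
    rw [mul_zero, add_zero] at lim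
    refine ge_of_tendsto lim ?_
    filter_upwards [eventually_gt_atTop 0, eventually_ge_atTop s₁, eventually_ge_atTop s₂,
      eventually_ge_atTop s₃] with R r0 r1 r2 r3 using step R r0 r1 r2 r3
  intro e₁ e₂ e₃ he1 he2 he3 hq1 hq2 hq3 s₁ s₂ s₃ h1 h2 h3 x
  refine abs_le.2 ⟨?_, main e₁ e₂ e₃ he1 he2 he3 hq1 hq2 hq3 s₁ s₂ s₃ h1 h2 h3 x⟩
  have := main (-e₁) e₂ e₃ (by simpa using he1) he2 he3 (fun k hk => by simp [hq1 k hk])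
    hq2 hq3 s₁ s₂ s₃ h1 h2 h3 x
  have e : ∀ v : EuclideanSpace ℝ (Fin d) → ℝ, dl (s₁ • (-e₁)) v x = - dl (s₁ • e₁) v x := by
    intro v
    simp [dl, sub_eq_add_neg]
  rw [e] at this
  linarith

lemma dl_double (p : EuclideanSpace ℝ (Fin d)) (g : EuclideanSpace ℝ (Fin d) → ℝ)
    (x : EuclideanSpace ℝ (Fin d)) :
    dl (p + p) g x = dl p g (x + p) + dl p g (x - p) := by
  simp only [dl]
  rw [show x + (p + p) = x + p + p by abel, show x - (p + p) = x - p - p by abel,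
    show x + p - p = x by abel, show x - p + p = x by abel]
  ring

lemma dl_double2 (p p' : EuclideanSpace ℝ (Fin d)) (g : EuclideanSpace ℝ (Fin d) → ℝ)
    (x : EuclideanSpace ℝ (Fin d)) :
    dl (p + p) (dl (p' + p') g) x = dl p (dl p' g) (x + p + p') + dl p (dl p' g) (x + p + -p')
      + dl p (dl p' g) (x + -p + p') + dl p (dl p' g) (x + -p + -p') := by
  rw [dl_double]
  have h : ∀ z, dl p (dl (p' + p') g) z = dl p (dl p' g) (z + p') + dl p (dl p' g) (z + -p') := by
    intro z
    rw [dl, dl_double, dl_double]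
    have k : ∀ w, dl p (dl p' g) w = dl p' g (w + p) - dl p' g (w - p) := fun _ => rfl
    rw [k, k]
    rw [show z + p' + p = z + p + p' by abel, show z + p' - p = z - p + p' by abel,
      show z + -p' + p = z + p - p' by abel, show z + -p' - p = z - p - p' by abel]
    ring
  rw [h, h, sub_eq_add_neg x p]
  ring

lemma inc {q : ℕ} {γ δ c : ℝ} {u : EuclideanSpace ℝ (Fin d) → ℝ} (hγ : γ = (2 + δ) / 3)
    (hδ : 0 < δ) (hc : 0 ≤ c)
    (hu : KB d q γ c u) {e e₁ e₂ : EuclideanSpace ℝ (Fin d)} (he : ‖e‖ = 1) (he1 : ‖e₁‖ = 1)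
    (he2 : ‖e₂‖ = 1) (hq : ∀ k : Fin d, q ≤ (k : ℕ) → e k = 0)
    (hq1 : ∀ k : Fin d, q ≤ (k : ℕ) → e₁ k = 0) (hq2 : ∀ k : Fin d, q ≤ (k : ℕ) → e₂ k = 0)
    {t : ℝ} (ht : 0 < t) (y : EuclideanSpace ℝ (Fin d)) :
    |dl (t • e₁) (dl (t • e₂) u) (y + t • e) - dl (t • e₁) (dl (t • e₂) u) y| ≤
      c * (t ^ 2 * t ^ δ) := by
  have h := hu e e₁ e₂ he he1 he2 hq hq1 hq2 (t / 2) t t (by positivity) ht.le ht.le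
    (y + (t / 2) • e)
  rw [dl, add_assoc, ← add_smul, add_halves, add_sub_cancel_right] at h
  refine h.trans (mul_le_mul_of_nonneg_left ?_ hc)
  have h1 : (t / 2 * t * t) ^ γ ≤ (t ^ (3 : ℝ)) ^ γ := by
    refine Real.rpow_le_rpow (by positivity) ?_ (by rw [hγ]; positivity)
    rw [show (3 : ℝ) = ((3 : ℕ) : ℝ) by norm_num, Real.rpow_natCast]
    nlinarith [pow_pos ht 3]
  refine h1.trans (le_of_eq ?_)
  rw [← Real.rpow_mul ht.le, ← Real.rpow_natCast t 2, ← Real.rpow_add ht]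
  congr 1
  rw [hγ]; push_cast; ring

lemma tele {q : ℕ} {γ δ c : ℝ} {u : EuclideanSpace ℝ (Fin d) → ℝ} (hγ : γ = (2 + δ) / 3)
    (hδ : 0 < δ) (hc : 0 ≤ c)
    (hu : KB d q γ c u) {e₁ e₂ : EuclideanSpace ℝ (Fin d)} (he1 : ‖e₁‖ = 1)
    (he2 : ‖e₂‖ = 1)
    (hq1 : ∀ k : Fin d, q ≤ (k : ℕ) → e₁ k = 0) (hq2 : ∀ k : Fin d, q ≤ (k : ℕ) → e₂ k = 0)
    {t : ℝ} (ht : 0 < t) (x : EuclideanSpace ℝ (Fin d)) :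
    |dl ((2 * t) • e₁) (dl ((2 * t) • e₂) u) x / (4 * (2 * t) ^ 2)
      - dl (t • e₁) (dl (t • e₂) u) x / (4 * t ^ 2)| ≤ c * t ^ δ := by
  have I1 := fun y => inc hγ hδ hc hu he1 he1 he2 hq1 hq1 hq2 ht y
  have I2 := fun y => inc hγ hδ hc hu he2 he1 he2 hq2 hq1 hq2 ht y
  have J1 := fun y => inc hγ hδ hc hu (e := -e₁) (by simpa using he1) he1 he2
    (fun k hk => by simp [hq1 k hk]) hq1 hq2 ht y
  have J2 := fun y => inc hγ hδ hc hu (e := -e₂) (by simpa using he2) he1 he2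
    (fun k hk => by simp [hq2 k hk]) hq1 hq2 ht y
  simp only [smul_neg] at J1 J2
  have hd2 : dl ((2 * t) • e₁) (dl ((2 * t) • e₂) u) x =
      dl (t • e₁ + t • e₁) (dl (t • e₂ + t • e₂) u) x := by
    rw [two_mul, add_smul, add_smul]
  rw [hd2, dl_double2]
  set W := dl (t • e₁) (dl (t • e₂) u) with hW
  have A1 := abs_le.1 (I1 x)
  have A2 := abs_le.1 (J1 x)
  have A3 := abs_le.1 (I2 (x + t • e₁))
  have A4 := abs_le.1 (J2 (x + t • e₁))
  have A5 := abs_le.1 (I2 (x + -(t • e₁)))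
  have A6 := abs_le.1 (J2 (x + -(t • e₁)))
  have B : |W (x + t • e₁ + t • e₂) + W (x + t • e₁ + -(t • e₂)) + W (x + -(t • e₁) + t • e₂)
      + W (x + -(t • e₁) + -(t • e₂)) - 4 * W x| ≤ 16 * t ^ 2 * (c * t ^ δ) := by
    have : 0 ≤ c * (t ^ 2 * t ^ δ) := by positivity
    rw [abs_le]
    constructor <;> nlinarith
  have e : ∀ S : ℝ, S / (4 * (2 * t) ^ 2) - W x / (4 * t ^ 2) = (S - 4 * W x) / (16 * t ^ 2) := by
    intro S
    field_simp
    ring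
  rw [e, abs_div, abs_of_pos (by positivity : 0 < 16 * t ^ 2), div_le_iff₀ (by positivity)]
  linarith

lemma mvl {u : EuclideanSpace ℝ (Fin d) → ℝ} (hu : ContDiff ℝ 2 u)
    {e₁ e₂ : EuclideanSpace ℝ (Fin d)} (he1 : ‖e₁‖ = 1) (he2 : ‖e₂‖ = 1)
    {t : ℝ} (ht : 0 < t) (x : EuclideanSpace ℝ (Fin d)) :
    ∃ y, dist y x ≤ 2 * t ∧
      dl (t • e₁) (dl (t • e₂) u) x / (4 * t ^ 2) = hs u y e₂ e₁ := by
  have hv := dl_contDiff hu (t • e₂)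
  obtain ⟨s, hs1, hs2⟩ := exists_hasDerivAt_eq_slope (fun s : ℝ => dl (t • e₂) u (x + s • e₁))
    (fun s => fderiv ℝ (dl (t • e₂) u) (x + s • e₁) e₁) (by linarith : -t < t)
    (fun s _ => (line_deriv1 hv x e₁ s).continuousAt.continuousWithinAt)
    (fun s _ => line_deriv1 hv x e₁ s)
  have hd2 : ∀ y : EuclideanSpace ℝ (Fin d), ∀ s : ℝ,
      HasDerivAt (fun t : ℝ => fderiv ℝ u (y + t • e₂) e₁) (hs u (y + s • e₂) e₂ e₁) s := by
    intro y s
    have h := ((fd_differentiable hu) (y + s • e₂)).hasFDerivAt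
    have h2 : HasDerivAt (fun t : ℝ => y + t • e₂) e₂ s := by
      simpa using ((hasDerivAt_id s).smul_const e₂).const_add y
    have h3 := h.comp_hasDerivAt s h2
    have := h3.clm_apply (hasDerivAt_const s e₁)
    simpa [hs] using this
  obtain ⟨r, hr1, hr2⟩ := exists_hasDerivAt_eq_slope
    (fun r : ℝ => fderiv ℝ u (x + s • e₁ + r • e₂) e₁)
    (fun r => hs u (x + s • e₁ + r • e₂) e₂ e₁) (by linarith : -t < t)
    (fun r _ => (hd2 _ r).continuousAt.continuousWithinAt)
    (fun r _ => hd2 _ r)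
  refine ⟨x + s • e₁ + r • e₂, ?_, ?_⟩
  · have h1 : |s| ≤ t := abs_le.2 ⟨hs1.1.le, hs1.2.le⟩
    have h2 : |r| ≤ t := abs_le.2 ⟨hr1.1.le, hr1.2.le⟩
    rw [dist_eq_norm, show x + s • e₁ + r • e₂ - x = s • e₁ + r • e₂ by abel]
    refine (norm_add_le _ _).trans ?_
    rw [norm_smul, norm_smul, he1, he2, Real.norm_eq_abs, Real.norm_eq_abs]
    linarith
  · rw [fderiv_dl (hu.differentiable (by norm_num))] at hs2
    simp only [neg_smul, ← sub_eq_add_neg, sub_apply, sub_neg_eq_add] at hs2 hr2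
    rw [hr2]
    have e1 : dl (t • e₁) (dl (t • e₂) u) x =
      dl (t • e₂) u (x + t • e₁) - dl (t • e₂) u (x - t • e₁) := rfl
    rw [e1]
    rw [hs2]
    field_simp
    ring

lemma conv {q : ℕ} {γ δ c : ℝ} {u : EuclideanSpace ℝ (Fin d) → ℝ} (hγ : γ = (2 + δ) / 3)
    (hδ : 0 < δ) (hc : 0 ≤ c) (hu2 : ContDiff ℝ 2 u)
    (hu : KB d q γ c u) {e₁ e₂ : EuclideanSpace ℝ (Fin d)} (he1 : ‖e₁‖ = 1)
    (he2 : ‖e₂‖ = 1)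
    (hq1 : ∀ k : Fin d, q ≤ (k : ℕ) → e₁ k = 0) (hq2 : ∀ k : Fin d, q ≤ (k : ℕ) → e₂ k = 0)
    {t : ℝ} (ht : 0 < t) (x : EuclideanSpace ℝ (Fin d)) :
    |dl (t • e₁) (dl (t • e₂) u) x / (4 * t ^ 2) - hs u x e₂ e₁| ≤
      c * t ^ δ / (1 - (2⁻¹ : ℝ) ^ δ) := by
  let F : ℕ → ℝ := fun n => dl ((t * 2⁻¹ ^ n) • e₁) (dl ((t * 2⁻¹ ^ n) • e₂) u) x /
    (4 * (t * 2⁻¹ ^ n) ^ 2)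
  have hr : (2⁻¹ : ℝ) ^ δ < 1 := Real.rpow_lt_one (by norm_num) (by norm_num) hδ
  have hpos : ∀ n : ℕ, 0 < t * 2⁻¹ ^ n := fun n => by positivity
  have hstep : ∀ n, dist (F n) (F (n + 1)) ≤ c * t ^ δ * ((2⁻¹ : ℝ) ^ δ) ^ n := by
    intro n
    have h := tele hγ hδ hc hu he1 he2 hq1 hq2 (hpos (n + 1)) x
    rw [show 2 * (t * 2⁻¹ ^ (n + 1)) = t * 2⁻¹ ^ n by rw [pow_succ]; ring] at h
    rw [Real.dist_eq]
    refine h.trans ?_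
    rw [mul_assoc]
    refine mul_le_mul_of_nonneg_left ?_ hc
    have e : t ^ δ * ((2⁻¹ : ℝ) ^ δ) ^ n = (t * 2⁻¹ ^ n) ^ δ := by
      rw [Real.mul_rpow ht.le (by positivity), ← Real.rpow_natCast, ← Real.rpow_natCast,
        ← Real.rpow_mul (by norm_num), ← Real.rpow_mul (by norm_num), mul_comm δ]
    rw [e]
    refine Real.rpow_le_rpow (hpos _).le ?_ hδ.le
    rw [pow_succ]
    nlinarith [hpos n]
  have hlim : Tendsto F atTop (nhds (hs u x e₂ e₁)) := by
    choose y hy1 hy2 using fun n => mvl hu2 he1 he2 (hpos n) x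
    have hF : F = fun n => hs u (y n) e₂ e₁ := funext hy2
    rw [hF]
    have hcont : Continuous fun x => hs u x e₂ e₁ :=
      ((hs_continuous hu2).clm_apply continuous_const).clm_apply continuous_const
    refine (hcont.tendsto x).comp ?_
    rw [tendsto_iff_dist_tendsto_zero]
    refine squeeze_zero (fun _ => dist_nonneg) hy1 ?_
    have := ((tendsto_pow_atTop_nhds_zero_of_lt_one (r := (2⁻¹ : ℝ)) (by norm_num)
      (by norm_num)).const_mul t).const_mul 2
    simpa using this
  have := dist_le_of_le_geometric_of_tendsto₀ _ _ hr hstep hlim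
  simpa [F, Real.dist_eq] using this


end

/-- **Theorem 2.1 (i)**: partial Schauder estimate on the whole space for non-divergence
form elliptic equations with coefficients independent of `x'`. -/
theorem partial_schauder_elliptic_wholespace
    (d q : ℕ) (ν δ : ℝ) (hd : 2 ≤ d) (hq1 : 1 ≤ q) (hqd : q < d)
    (hν : ν ∈ Ioc (0 : ℝ) 1) (hδ : δ ∈ Ioo (0 : ℝ) 1) :
    ∃ N : ℝ, 0 < N ∧
      ∀ (a : Fin d → Fin d → EuclideanSpace ℝ (Fin d) → ℝ)
        (u f : EuclideanSpace ℝ (Fin d) → ℝ),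
        (∀ i j, Measurable (a i j)) →
        (∀ i j x, a i j x = a j i x) →
        UnifElliptic d ν a →
        (∀ i j (x y : EuclideanSpace ℝ (Fin d)),
          (∀ k : Fin d, q ≤ (k : ℕ) → x k = y k) → a i j x = a i j y) →
        ContDiff ℝ 2 u →
        (∃ M : ℝ, ∀ x, |u x| ≤ M) →
        (∀ᵐ x ∂(volume : Measure (EuclideanSpace ℝ (Fin d))),
          ∑ i, ∑ j, a i j x * pd2 i j u x = f x) →
        ∀ K : ℝ, 0 ≤ K → PHolderX d q δ univ f K →
          ∀ i j : Fin d, (i : ℕ) < q → (j : ℕ) < q →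
            PHolderX d q δ univ (pd2 i j u) (N * K) := by
  obtain ⟨γ, hγ⟩ : ∃ γ : ℝ, γ = (2 + δ) / 3 := ⟨_, rfl⟩
  obtain ⟨C, hC⟩ : ∃ C : ℝ, C = 24 / (ν * (γ * (1 - γ))) := ⟨_, rfl⟩
  have hγ0 : 0 < γ := by rw [hγ]; linarith [hδ.1]
  have hγ1 : 0 < 1 - γ := by rw [hγ]; linarith [hδ.2]
  have hν0 := hν.1
  have hC0 : 0 < C := by rw [hC]; positivity
  have hr : 0 < 1 - (2⁻¹ : ℝ) ^ δ :=
    sub_pos.2 (Real.rpow_lt_one (by norm_num) (by norm_num) hδ.1)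
  refine ⟨C + 2 * (C / (1 - (2⁻¹ : ℝ) ^ δ)), by positivity, ?_⟩
  intro a u f _ hsymm hA ha hu hM hL K hK hf i j hi hj x _ y _ hxy
  obtain ⟨M, hM⟩ := hM
  have hkb := key hν hδ hγ hC hsymm hA ha hu hM hL hK hf
  have hc : 0 ≤ C * K := by positivity
  rcases eq_or_ne x y with h | hne
  · subst h
    simp only [sub_self, abs_zero]
    positivity
  obtain ⟨t, ht⟩ : ∃ t : ℝ, t = dist x y := ⟨_, rfl⟩
  have ht0 : 0 < t := by rw [ht]; exact dist_pos.2 hne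
  have hsing : ∀ i : Fin d, (i : ℕ) < q → ∀ k : Fin d, q ≤ (k : ℕ) →
      (EuclideanSpace.single i (1 : ℝ) : EuclideanSpace ℝ (Fin d)) k = 0 := by
    intro i hi k hk
    have : k ≠ i := by rintro rfl; omega
    simp [this]
  have hn : ∀ i : Fin d, ‖(EuclideanSpace.single i (1 : ℝ) : EuclideanSpace ℝ (Fin d))‖ = 1 := by
    intro i; simp
  have c1 := conv hγ hδ.1 hc hu hkb (hn j) (hn i) (hsing j hj) (hsing i hi) ht0 x
  have c2 := conv hγ hδ.1 hc hu hkb (hn j) (hn i) (hsing j hj) (hsing i hi) ht0 y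
  have c3 := inc hγ hδ.1 hc hkb (e := t⁻¹ • (y - x))
    (by rw [norm_smul, norm_inv, Real.norm_eq_abs, abs_of_pos ht0, ← dist_eq_norm, dist_comm,
          ← ht, inv_mul_cancel₀ ht0.ne'])
    (hn j) (hn i) (fun k hk => by simp [hxy k hk]) (hsing j hj) (hsing i hi) ht0 x
  rw [smul_smul, mul_inv_cancel₀ ht0.ne', one_smul, add_sub_cancel] at c3
  rw [pd2_eq hu, pd2_eq hu, ← ht]
  set P := dl (t • EuclideanSpace.single j (1 : ℝ)) (dl (t • EuclideanSpace.single i (1 : ℝ)) u)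
  have c4 : |P y / (4 * t ^ 2) - P x / (4 * t ^ 2)| ≤ C * K * t ^ δ := by
    rw [← sub_div, abs_div, abs_of_pos (by positivity : 0 < 4 * t ^ 2), div_le_iff₀ (by positivity)]
    have : 0 ≤ C * K * (t ^ 2 * t ^ δ) := by positivity
    nlinarith
  have e : (C + 2 * (C / (1 - (2⁻¹ : ℝ) ^ δ))) * K * t ^ δ =
      C * K * t ^ δ + 2 * (C * K * t ^ δ / (1 - (2⁻¹ : ℝ) ^ δ)) := by
    ring
  rw [e]
  have d1 := abs_le.1 c1
  have d2 := abs_le.1 c2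
  have d4 := abs_le.1 c4
  rw [abs_le]
  constructor <;> linarith
end
end

section
/- Theorem 2.1(ii): Suppose the symmetric, measurable, uniformly elliptic coefficients a^{ij} on ℝ^d are independent of x', i.e. a^{ij}(x',x'') = a^{ij}(y',x'') for all x', y' ∈ ℝ^q and x'' ∈ ℝ^{d−q}. Let δ ∈ (0,1), let f : B_1 → ℝ satisfy [f]_{x',δ;B_1} < ∞, and let u be a bounded classical solution of a^{ij}D_{ij}u = f in B_1. Then there is a constant N depending only on d, q, ν, δ such that [u]_{x',2+δ;B_{1/2}} ≤ N ( [f]_{x',δ;B_1} + sup_{B_1} |u| ). -/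
open MeasureTheory Metric Set Filter

noncomputable section

/-- `g` has second derivative `b` at `0`. -/
def HasSD (g : ℝ → ℝ) (b : ℝ) : Prop :=
  ∃ g' : ℝ → ℝ, (∀ᶠ t in nhds (0:ℝ), HasDerivAt g (g' t) t) ∧ HasDerivAt g' b 0

lemma HasSD.add {g h : ℝ → ℝ} {b c : ℝ} (hg : HasSD g b) (hh : HasSD h c) :
    HasSD (fun t => g t + h t) (b + c) := by
  obtain ⟨g', h1, h2⟩ := hg
  obtain ⟨h', h3, h4⟩ := hh
  refine ⟨fun t => g' t + h' t, ?_, h2.add h4⟩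
  filter_upwards [h1, h3] with t ht1 ht2 using ht1.add ht2

lemma HasSD.const_mul {g : ℝ → ℝ} {b : ℝ} (k : ℝ) (hg : HasSD g b) :
    HasSD (fun t => k * g t) (k * b) := by
  obtain ⟨g', h1, h2⟩ := hg
  refine ⟨fun t => k * g' t, ?_, h2.const_mul k⟩
  filter_upwards [h1] with t ht1 using ht1.const_mul k

lemma HasSD.sub {g h : ℝ → ℝ} {b c : ℝ} (hg : HasSD g b) (hh : HasSD h c) :
    HasSD (fun t => g t - h t) (b - c) := by
  have := hg.add (hh.const_mul (-1))
  convert this using 1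
  · funext t; ring
  · ring

lemma HasSD.sum {ι : Type*} (s : Finset ι) {g : ι → ℝ → ℝ} {b : ι → ℝ}
    (hg : ∀ i ∈ s, HasSD (g i) (b i)) :
    HasSD (fun t => ∑ i ∈ s, g i t) (∑ i ∈ s, b i) := by
  classical
  induction s using Finset.induction_on with
  | empty =>
    simp only [Finset.sum_empty]
    exact ⟨fun _ => 0, Eventually.of_forall fun t => hasDerivAt_const t _, hasDerivAt_const _ _⟩
  | insert a s ha ih =>
    simp only [Finset.sum_insert ha]
    exact (hg a (by simp)).add (ih fun i hi => hg i (by simp [hi]))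

lemma HasSD.deriv_deriv {g : ℝ → ℝ} {b : ℝ} (hg : HasSD g b) : deriv (deriv g) 0 = b := by
  obtain ⟨g', h1, h2⟩ := hg
  have : deriv g =ᶠ[nhds 0] g' := by
    filter_upwards [h1] with t ht using ht.deriv
  rw [this.deriv_eq]; exact h2.deriv

lemma HasSD.nonneg_of_isLocalMin {g : ℝ → ℝ} {b : ℝ} (hg : HasSD g b) (hm : IsLocalMin g 0) :
    0 ≤ b := by
  by_contra hb
  push Not at hb
  have hneg := (hg.const_mul (-1))
  have hdd := hneg.deriv_deriv
  have hmax : IsLocalMin (fun t => -1 * g t) 0 := by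
    apply isLocalMin_of_deriv_deriv_pos
    · rw [hdd]; linarith
    · have : IsLocalMax (fun t => -1 * g t) 0 := by
        filter_upwards [hm] with t ht
        linarith
      exact this.deriv_eq_zero
    · obtain ⟨g', h1, h2⟩ := hneg
      exact h1.self_of_nhds.continuousAt
  have hc : g =ᶠ[nhds 0] fun _ => g 0 := by
    filter_upwards [hm, hmax] with t h1 h2
    linarith
  have h0 : deriv (deriv g) 0 = 0 := by
    have h1 : deriv g =ᶠ[nhds 0] deriv (fun _ => g 0) := hc.deriv
    rw [h1.deriv_eq]
    simp
  rw [hg.deriv_deriv] at h0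
  linarith

lemma HasSD.tendsto {g : ℝ → ℝ} {b : ℝ} (hg : HasSD g b) :
    Tendsto (fun t => (g t - 2 * g 0 + g (-t)) / t ^ 2) (nhdsWithin 0 (Ioi 0)) (nhds b) := by
  obtain ⟨g', h1, h2⟩ := hg
  have hn : Tendsto (fun t : ℝ => -t) (nhds 0) (nhds 0) := by
    simpa using (continuous_neg (G := ℝ)).tendsto 0
  have h1n := hn.eventually h1
  have hle : nhdsWithin (0:ℝ) (Ioi 0) ≤ nhds 0 := nhdsWithin_le_nhds
  have hcont : ContinuousAt g 0 := h1.self_of_nhds.continuousAt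
  apply HasDerivAt.lhopital_zero_nhdsGT (f' := fun t => g' t - g' (-t)) (g' := fun t => 2 * t)
  · filter_upwards [hle h1, hle h1n] with t ht htn
    have := ht.sub_const (2 * g 0)
    have h3 := htn.scomp t (hasDerivAt_neg t)
    have := this.add h3
    refine HasDerivAt.congr_deriv (f' := _) this ?_
    simp [sub_eq_add_neg]
  · filter_upwards with t
    simpa using hasDerivAt_pow 2 t
  · filter_upwards [self_mem_nhdsWithin] with t ht
    have : (0:ℝ) < t := ht
    positivity
  · have hgn : Tendsto (fun t => g (-t)) (nhds 0) (nhds (g 0)) := by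
      have := hcont.tendsto
      exact this.comp hn
    have := ((hcont.tendsto.sub_const (2 * g 0)).add hgn).mono_left hle
    convert this using 2
    ring
  · have : Tendsto (fun t : ℝ => t ^ 2) (nhds 0) (nhds (0 ^ 2)) := (continuous_pow 2).tendsto 0
    simpa using this.mono_left hle
  · have hd : HasDerivAt (fun t => g' t - g' (-t)) (b + b) 0 := by
      have h3 : HasDerivAt (fun t => g' (-t)) (-b) 0 := by
        have h2' : HasDerivAt g' b (-0) := by simpa using h2
        have := h2'.scomp (0:ℝ) (hasDerivAt_neg (0:ℝ))
        simpa [Function.comp_def] using this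
      exact HasDerivAt.congr_deriv (h2.sub h3) (by ring)
    have := hd.tendsto_slope_zero_right
    have h4 := this.const_mul (1/2)
    have e : (1/2 : ℝ) * (b + b) = b := by ring
    rw [e] at h4
    refine h4.congr' ?_
    filter_upwards [self_mem_nhdsWithin] with t ht
    have : (0:ℝ) < t := ht
    simp
    field_simp

/-- second derivative of `t ↦ t ^ p` -/
lemma hasSD_rpow {Y p : ℝ} (hY : 0 < Y) :
    HasSD (fun t => (Y + t) ^ p) (p * (p - 1) * Y ^ (p - 2)) := by
  refine ⟨fun t => p * (Y + t) ^ (p - 1), ?_, ?_⟩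
  · have : ∀ᶠ t in nhds (0:ℝ), 0 < Y + t := by
      have hc : ContinuousAt (fun t : ℝ => Y + t) 0 := by fun_prop
      exact hc.eventually (lt_mem_nhds (by simpa using hY))
    filter_upwards [this] with t ht
    have := ((hasDerivAt_id t).const_add Y).rpow_const (p := p) (Or.inl ht.ne')
    simpa using this
  · have := (((hasDerivAt_id (0:ℝ)).const_add Y).rpow_const (p := p - 1)
      (Or.inl (by simpa using hY.ne'))).const_mul p
    refine HasDerivAt.congr_deriv this ?_
    simp
    rw [show p - 1 - 1 = p - 2 by ring]
    ring

lemma hasSD_quad (m : ℕ) {α β γ : ℝ} (hα : 0 < α) :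
    HasSD (fun t => ((α - β * t - γ * t ^ 2) ^ m)⁻¹)
      ((m * (m + 1) * β ^ 2 / α ^ (m + 2)) + 2 * m * γ / α ^ (m + 1)) := by
  have hd : ∀ t, HasDerivAt (fun t : ℝ => α - β * t - γ * t ^ 2) (- β - 2 * γ * t) t := by
    intro t
    have := (((hasDerivAt_id t).const_mul β).const_sub α).sub ((hasDerivAt_pow 2 t).const_mul γ)
    refine HasDerivAt.congr_deriv this ?_
    simp; ring
  have hpos : ∀ᶠ t in nhds (0:ℝ), 0 < α - β * t - γ * t ^ 2 := by
    have hc : ContinuousAt (fun t : ℝ => α - β * t - γ * t ^ 2) 0 := by fun_prop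
    exact hc.eventually (lt_mem_nhds (by simpa using hα))
  refine ⟨fun t => (m * (β + 2 * γ * t)) * ((α - β * t - γ * t ^ 2) ^ (m + 1))⁻¹, ?_, ?_⟩
  · filter_upwards [hpos] with t ht
    have := ((hd t).pow m).inv (pow_pos ht m).ne'
    refine HasDerivAt.congr_deriv this ?_
    rcases m with _ | m
    · simp
    · simp only [Nat.add_sub_cancel]
      simp only [Pi.pow_apply]
      clear this
      generalize α - β * t - γ * t ^ 2 = r at ht ⊢
      field_simp
      push_cast
      ring
  · have h1 : HasDerivAt (fun t : ℝ => (m * (β + 2 * γ * t))) (m * (2 * γ)) 0 := by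
      have := (((hasDerivAt_id (0:ℝ)).const_mul (2 * γ)).const_add β).const_mul (m : ℝ)
      simpa using this
    have h2 := ((hd 0).pow (m + 1)).inv (pow_pos (by simpa using hα) (m + 1)).ne'
    have := h1.mul h2
    refine HasDerivAt.congr_deriv this ?_
    simp
    field_simp
    ring

set_option maxHeartbeats 1000000 in
lemma core_interior {E : Type*} [NormedAddCommGroup E] [InnerProductSpace ℝ E]
    {n D : ℕ} {p δ Λ c κ K s ε : ℝ} (hp : 0 < p) (hp1 : p < 1)
    (hpd : ((n:ℝ) + 1) * p ≤ 2 + δ) (hδ : 0 < δ) (hc : 0 < c) (hκ : 0 < κ) (hκ1 : κ ≤ 1)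
    (hκΛ : κ ^ 2 * ((4 * (n + 1) * (n + 2) + 2 * (n + 1)) * Λ) ≤ c * p * (1 - p) / 2)
    (hs : 2 * K < s * (c * p * (1 - p))) (hK : 0 ≤ K) (hε : 0 < ε)
    (Φ : E → (Fin (n + 1) → ℝ) → ℝ)
    (hpde : ∀ x y, ‖x‖ < 1 → (∀ i, 0 < y i ∧ y i < κ * (1 - ‖x‖ ^ 2)) →
      ∃ (v : Fin D → E) (b : Fin D → ℝ) (b' : Fin (n + 1) → ℝ), ∑ l, ‖v l‖ ^ 2 ≤ Λ ∧
        (∀ l, HasSD (fun t => Φ (x + t • v l) y) (b l)) ∧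
        (∀ i, HasSD (fun t => Φ x (y + t • Pi.single i 1)) (b' i)) ∧
        ∀ i, -(K * y i ^ δ) ≤ ∑ l, b l + c * ∑ i, b' i)
    (x : E) (Y : Fin (n + 1) → ℝ) (hx : ‖x‖ < 1)
    (hY : ∀ i, ε < Y i ∧ Y i < κ * (1 - ‖x‖ ^ 2))
    (hmin1 : ∀ v : E, IsLocalMin (fun t : ℝ => s * (∏ i, Y i) ^ p *
      ((1 - ‖x + t • v‖ ^ 2) ^ (n + 1))⁻¹ - Φ (x + t • v) (fun j => Y j - ε)) 0)
    (hmin2 : ∀ i, IsLocalMin (fun t : ℝ => s * (∏ j, (Y + t • (Pi.single i (1:ℝ) : Fin (n + 1) → ℝ)) j) ^ p *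
      ((1 - ‖x‖ ^ 2) ^ (n + 1))⁻¹ - Φ x ((fun j => Y j - ε) + t • Pi.single i 1)) 0) :
    False := by
  have hYpos : ∀ i, 0 < Y i := fun i => hε.trans (hY i).1
  have hα : 0 < 1 - ‖x‖ ^ 2 := by nlinarith [norm_nonneg x]
  have hα1 : 1 - ‖x‖ ^ 2 ≤ 1 := by nlinarith [norm_nonneg x]
  set α := 1 - ‖x‖ ^ 2 with hαdef
  obtain ⟨v, b, b', hv, hb, hb', hineq⟩ := hpde x (fun j => Y j - ε) hx
    (fun i => ⟨by linarith [(hY i).1], by linarith [(hY i).2]⟩)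
  set F := (∏ i, Y i) ^ p with hF
  have hFpos : 0 < F := Real.rpow_pos_of_pos (Finset.prod_pos fun i _ => hYpos i) p
  have hcp : 0 < c * p * (1 - p) := by have : 0 < 1 - p := by linarith
                                       positivity
  have hs0 : 0 < s := by
    by_contra h
    push Not at h
    nlinarith
  have hm : (0:ℝ) ≤ n := Nat.cast_nonneg n
  set C1 : ℝ := 4 * (n + 1) * (n + 2) + 2 * (n + 1) with hC1
  have hC1pos : 0 < C1 := by positivity
  -- x-directions
  have hX : ∀ l, b l ≤ s * F * (C1 * ‖v l‖ ^ 2 / α ^ (n + 3)) := by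
    intro l
    have h1 := hasSD_quad (n + 1) (α := α) (β := 2 * inner ℝ x (v l)) (γ := ‖v l‖ ^ 2) hα
    have h2 := (h1.const_mul (s * F)).sub (hb l)
    have h3 := h2.nonneg_of_isLocalMin (by
      have := hmin1 (v l)
      refine this.congr (Eventually.of_forall fun t => ?_)
      have e : 1 - ‖x + t • v l‖ ^ 2 = α - 2 * inner ℝ x (v l) * t - ‖v l‖ ^ 2 * t ^ 2 := by
        rw [norm_add_sq_real, hαdef, inner_smul_right, norm_smul, mul_pow, Real.norm_eq_abs, sq_abs]
        ring
      simp only [e])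
    have h4 : (((n + 1 : ℕ) : ℝ) * (((n + 1 : ℕ) : ℝ) + 1) * (2 * inner ℝ x (v l)) ^ 2 / α ^ (n + 1 + 2)) +
      2 * ((n + 1 : ℕ) : ℝ) * ‖v l‖ ^ 2 / α ^ (n + 1 + 1) ≤ C1 * ‖v l‖ ^ 2 / α ^ (n + 3) := by
      have e1 : 2 * ((n + 1 : ℕ) : ℝ) * ‖v l‖ ^ 2 / α ^ (n + 1 + 1) =
        2 * ((n + 1 : ℕ) : ℝ) * ‖v l‖ ^ 2 * α / α ^ (n + 3) := by
        rw [show α ^ (n + 3) = α ^ (n + 1 + 1) * α by ring]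
        field_simp
      rw [e1, ← add_div]
      have hin : (inner ℝ x (v l)) ^ 2 ≤ ‖v l‖ ^ 2 := by
        have h5 := abs_real_inner_le_norm x (v l)
        have h6 : |inner ℝ x (v l)| ≤ ‖v l‖ := by nlinarith [norm_nonneg (v l)]
        exact sq_le_sq' (by linarith [neg_abs_le (inner ℝ x (v l))]) ((le_abs_self _).trans h6)
      gcongr
      push_cast
      have h7 : (0:ℝ) ≤ (n + 1) * (n + 1 + 1) := by positivity
      have h8 : (0:ℝ) ≤ 2 * (n + 1) * ‖v l‖ ^ 2 := by positivity
      nlinarith [mul_le_mul_of_nonneg_left hin h7, mul_le_mul_of_nonneg_left hα1 h8]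
    have h5 := mul_le_mul_of_nonneg_left h4 (mul_pos hs0 hFpos).le
    linarith
  -- y-directions
  have hYd : ∀ i, b' i ≤ s * F * (p * (p - 1) * (Y i ^ 2)⁻¹) / α ^ (n + 1) := by
    intro i
    have h1 := hasSD_rpow (p := p) (hYpos i)
    have h2 := (h1.const_mul (s * (∏ j ∈ Finset.univ.erase i, Y j) ^ p * (α ^ (n + 1))⁻¹)).sub (hb' i)
    have h3 := h2.nonneg_of_isLocalMin (by
      have hm2 := hmin2 i
      have hev : (fun t : ℝ => s * (∏ j, (Y + t • (Pi.single i (1:ℝ) : Fin (n + 1) → ℝ)) j) ^ p *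
          (α ^ (n + 1))⁻¹ - Φ x ((fun j => Y j - ε) + t • Pi.single i 1)) =ᶠ[nhds 0]
          (fun t => s * (∏ j ∈ Finset.univ.erase i, Y j) ^ p * (α ^ (n + 1))⁻¹ * (Y i + t) ^ p -
            Φ x ((fun j => Y j - ε) + t • Pi.single i 1)) := by
        have hc0 : ContinuousAt (fun t : ℝ => Y i + t) 0 := by fun_prop
        have hpos : ∀ᶠ t in nhds (0:ℝ), 0 < Y i + t :=
          hc0.eventually (lt_mem_nhds (by simpa using hYpos i))
        filter_upwards [hpos] with t ht
        have : ∏ j, (Y + t • (Pi.single i (1:ℝ) : Fin (n + 1) → ℝ)) j =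
            (Y i + t) * ∏ j ∈ Finset.univ.erase i, Y j := by
          rw [← Finset.mul_prod_erase _ _ (Finset.mem_univ i)]
          congr 1
          · simp
          · apply Finset.prod_congr rfl
            intro j hj
            simp [Finset.ne_of_mem_erase hj]
        rw [this, Real.mul_rpow ht.le (Finset.prod_nonneg fun j _ => (hYpos j).le)]
        ring
      exact hm2.congr hev)
    have h4 : F = (Y i) ^ p * (∏ j ∈ Finset.univ.erase i, Y j) ^ p := by
      rw [hF, ← Finset.mul_prod_erase _ _ (Finset.mem_univ i),
        Real.mul_rpow (hYpos i).le (Finset.prod_nonneg fun j _ => (hYpos j).le)]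
    have h5 : Y i ^ (p - 2) = Y i ^ p * (Y i ^ 2)⁻¹ := by
      rw [Real.rpow_sub (hYpos i)]
      simp [div_eq_mul_inv]
    rw [h5] at h3
    rw [h4]
    have : s * (Y i ^ p * (∏ j ∈ Finset.univ.erase i, Y j) ^ p) * (p * (p - 1) * (Y i ^ 2)⁻¹) / α ^ (n + 1) = s * (∏ j ∈ Finset.univ.erase i, Y j) ^ p * (α ^ (n + 1))⁻¹ * (p * (p - 1) * (Y i ^ p * (Y i ^ 2)⁻¹)) := by
      ring
    linarith
  obtain ⟨k, -, hk⟩ := Finset.exists_min_image Finset.univ Y ⟨0, Finset.mem_univ _⟩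
  have hk' : ∀ j, Y k ≤ Y j := fun j => hk j (Finset.mem_univ j)
  have hYk1 : Y k ≤ 1 := by nlinarith [(hY k).2]
  have hI := hineq k
  have hsum1 : ∑ l, b l ≤ s * F * (C1 * Λ / α ^ (n + 3)) := by
    calc ∑ l, b l ≤ ∑ l, s * F * (C1 * ‖v l‖ ^ 2 / α ^ (n + 3)) := Finset.sum_le_sum fun l _ => hX l
      _ = s * F * (C1 * (∑ l, ‖v l‖ ^ 2) / α ^ (n + 3)) := by
        rw [Finset.mul_sum, Finset.sum_div, Finset.mul_sum]
      _ ≤ _ := by gcongr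
  have hnn : ∀ i, b' i ≤ 0 := by
    intro i
    refine (hYd i).trans ?_
    have h1 : p * (p - 1) ≤ 0 := by nlinarith
    have h2 : 0 ≤ s * F * (Y i ^ 2)⁻¹ / α ^ (n + 1) := by
      have := hYpos i
      positivity
    have : s * F * (p * (p - 1) * (Y i ^ 2)⁻¹) / α ^ (n + 1) = (p * (p - 1)) * (s * F * (Y i ^ 2)⁻¹ / α ^ (n + 1)) := by ring
    rw [this]
    exact mul_nonpos_of_nonpos_of_nonneg h1 h2
  have hsum2 : ∑ i, b' i ≤ s * F * (p * (p - 1) * (Y k ^ 2)⁻¹) / α ^ (n + 1) := by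
    rw [← Finset.add_sum_erase _ _ (Finset.mem_univ k)]
    have := Finset.sum_nonpos (s := Finset.univ.erase k) (f := b') fun i _ => hnn i
    linarith [hYd k]
  have hΛ : 0 ≤ Λ := le_trans (Finset.sum_nonneg fun l _ => sq_nonneg _) hv
  -- absorb
  have habs : C1 * Λ / α ^ (n + 3) ≤ (c * p * (1 - p) / 2) * (Y k ^ 2)⁻¹ / α ^ (n + 1) := by
    have hYk := hYpos k
    have h1 : Y k ^ 2 ≤ κ ^ 2 * α ^ 2 := by
      rw [← mul_pow]; exact pow_le_pow_left₀ hYk.le (hY k).2.le 2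
    rw [div_le_div_iff₀ (by positivity) (by positivity)]
    have h2 : C1 * Λ * Y k ^ 2 ≤ (c * p * (1 - p) / 2) * α ^ 2 := by
      calc C1 * Λ * Y k ^ 2 ≤ C1 * Λ * (κ ^ 2 * α ^ 2) := by gcongr
        _ = (κ ^ 2 * (C1 * Λ)) * α ^ 2 := by ring
        _ ≤ _ := by gcongr
    have h3 : C1 * Λ ≤ (c * p * (1 - p) / 2) * α ^ 2 * (Y k ^ 2)⁻¹ := by
      rw [← div_eq_mul_inv, le_div_iff₀ (by positivity)]; exact h2
    calc C1 * Λ * α ^ (n + 1) ≤ (c * p * (1 - p) / 2) * α ^ 2 * (Y k ^ 2)⁻¹ * α ^ (n + 1) := by gcongr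
      _ = _ := by ring
  have hFlow : Y k ^ δ ≤ F * (Y k ^ 2)⁻¹ / α ^ (n + 1) := by
    have hYk := hYpos k
    have h1 : (Y k) ^ (n + 1) ≤ ∏ i, Y i := by
      calc (Y k) ^ (n + 1) = ∏ i : Fin (n + 1), Y k := by simp
        _ ≤ _ := Finset.prod_le_prod (fun _ _ => hYk.le) fun j _ => hk' j
    have h2 : (Y k) ^ (2 + δ) ≤ F := by
      calc (Y k) ^ (2 + δ) ≤ (Y k) ^ (((n:ℝ) + 1) * p) :=
            Real.rpow_le_rpow_of_exponent_ge hYk hYk1 hpd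
        _ = ((Y k) ^ (n + 1)) ^ p := by
            rw [Real.rpow_mul hYk.le]; norm_cast
        _ ≤ F := Real.rpow_le_rpow (by positivity) h1 hp.le
    have h3 : (Y k) ^ (2 + δ) = Y k ^ 2 * Y k ^ δ := by
      rw [Real.rpow_add hYk]; norm_cast
    have h4 : α ^ (n + 1) ≤ 1 := pow_le_one₀ hα.le hα1
    rw [le_div_iff₀ (by positivity), ← div_eq_mul_inv, le_div_iff₀ (by positivity)]
    have h5 : 0 < Y k ^ δ := Real.rpow_pos_of_pos hYk δ
    calc Y k ^ δ * α ^ (n + 1) * Y k ^ 2 ≤ Y k ^ δ * 1 * Y k ^ 2 := by gcongr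
      _ = Y k ^ (2 + δ) := by rw [h3]; ring
      _ ≤ F := h2
  have hKd : K * (Y k - ε) ^ δ ≤ K * Y k ^ δ := by
    gcongr
    · linarith [(hY k).1]
    · linarith
  have h5 : 0 < Y k ^ δ := Real.rpow_pos_of_pos (hYpos k) δ
  have hA := mul_le_mul_of_nonneg_left habs (mul_pos hs0 hFpos).le
  have hB := mul_le_mul_of_nonneg_left hsum2 hc.le
  have e1 : s * F * ((c * p * (1 - p) / 2) * (Y k ^ 2)⁻¹ / α ^ (n + 1)) +
    c * (s * F * (p * (p - 1) * (Y k ^ 2)⁻¹) / α ^ (n + 1)) =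
      - (s * (c * p * (1 - p)) / 2) * (F * (Y k ^ 2)⁻¹ / α ^ (n + 1)) := by ring
  have hC := mul_le_mul_of_nonneg_left hFlow (show 0 ≤ s * (c * p * (1 - p)) / 2 by positivity)
  have hD := mul_lt_mul_of_pos_right hs h5
  linarith

lemma core {E : Type*} [NormedAddCommGroup E] [InnerProductSpace ℝ E] [FiniteDimensional ℝ E]
    {n D : ℕ} {p δ Λ c κ K s G : ℝ} (hp : 0 < p) (hp1 : p < 1)
    (hpd : ((n:ℝ) + 1) * p ≤ 2 + δ) (hδ : 0 < δ) (hc : 0 < c) (hκ : 0 < κ) (hκ1 : κ ≤ 1)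
    (hκΛ : κ ^ 2 * ((4 * (n + 1) * (n + 2) + 2 * (n + 1)) * Λ) ≤ c * p * (1 - p) / 2)
    (hs : 2 * K < s * (c * p * (1 - p))) (hK : 0 ≤ K) (hG : 0 ≤ G) (hsG : G ≤ s * κ ^ p)
    (Φ : E → (Fin (n + 1) → ℝ) → ℝ)
    (hcont : ContinuousOn (fun z : E × (Fin (n + 1) → ℝ) => Φ z.1 z.2)
      {z | ‖z.1‖ < 1 ∧ ∀ i, 0 ≤ z.2 i ∧ z.2 i ≤ κ * (1 - ‖z.1‖ ^ 2)})
    (hzero : ∀ x y i, y i = 0 → Φ x y = 0)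
    (hface : ∀ x y, ‖x‖ < 1 → (∀ i, 0 ≤ y i ∧ y i ≤ κ * (1 - ‖x‖ ^ 2)) → ∀ i : Fin (n + 1),
      Φ x y ≤ G * (∏ j, y (i.succAbove j)) ^ p / (1 - ‖x‖ ^ 2) ^ n)
    (hpde : ∀ x y, ‖x‖ < 1 → (∀ i, 0 < y i ∧ y i < κ * (1 - ‖x‖ ^ 2)) →
      ∃ (v : Fin D → E) (b : Fin D → ℝ) (b' : Fin (n + 1) → ℝ), ∑ l, ‖v l‖ ^ 2 ≤ Λ ∧
        (∀ l, HasSD (fun t => Φ (x + t • v l) y) (b l)) ∧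
        (∀ i, HasSD (fun t => Φ x (y + t • Pi.single i 1)) (b' i)) ∧
        ∀ i, -(K * y i ^ δ) ≤ ∑ l, b l + c * ∑ i, b' i)
    (x : E) (y : Fin (n + 1) → ℝ) (hx : ‖x‖ < 1)
    (hy : ∀ i, 0 ≤ y i ∧ y i < κ * (1 - ‖x‖ ^ 2)) :
    Φ x y ≤ s * (∏ i, y i) ^ p / (1 - ‖x‖ ^ 2) ^ (n + 1) := by
  have hcp : 0 < c * p * (1 - p) := by have : 0 < 1 - p := by linarith
                                       positivity
  have hs0 : 0 < s := by
    by_contra h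
    push Not at h
    nlinarith
  have key : ∀ ε > 0, (∀ i, y i + ε ≤ κ * (1 - ‖x‖ ^ 2)) →
      Φ x y ≤ s * (∏ i, (y i + ε)) ^ p * ((1 - ‖x‖ ^ 2) ^ (n + 1))⁻¹ := by
    intro ε hε hyε
    let S : Set (E × (Fin (n + 1) → ℝ)) := {z | ∀ i, ε ≤ z.2 i ∧ z.2 i ≤ κ * (1 - ‖z.1‖ ^ 2)}
    let Ψ : E × (Fin (n + 1) → ℝ) → ℝ := fun z =>
      s * (∏ i, z.2 i) ^ p * ((1 - ‖z.1‖ ^ 2) ^ (n + 1))⁻¹ - Φ z.1 (fun j => z.2 j - ε)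
    have hSd : ∀ z ∈ S, 0 < 1 - ‖z.1‖ ^ 2 := by
      intro z hz
      have := hz 0
      by_contra h
      push Not at h
      nlinarith [this.1, this.2]
    have hSn : ∀ z ∈ S, ‖z.1‖ < 1 := by
      intro z hz
      have := hSd z hz
      by_contra h
      push Not at h
      nlinarith
    have hScl : IsClosed S := by
      have hS : S = ⋂ i, ({z : E × (Fin (n + 1) → ℝ) | ε ≤ z.2 i} ∩
          {z : E × (Fin (n + 1) → ℝ) | z.2 i ≤ κ * (1 - ‖z.1‖ ^ 2)}) := by
        ext z
        simp [S]
      rw [hS]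
      apply isClosed_iInter
      intro i
      apply IsClosed.inter
      · exact isClosed_le (f := fun _ : E × (Fin (n + 1) → ℝ) => ε) (g := fun z => z.2 i)
          (by fun_prop) (by fun_prop)
      · exact isClosed_le (f := fun z : E × (Fin (n + 1) → ℝ) => z.2 i)
          (g := fun z => κ * (1 - ‖z.1‖ ^ 2)) (by fun_prop) (by fun_prop)
    have hSc : IsCompact S := by
      refine IsCompact.of_isClosed_subset
        ((isCompact_closedBall (0:E) 1).prod (isCompact_univ_pi
          (fun i : Fin (n + 1) => isCompact_Icc (a := (0:ℝ)) (b := 1)))) hScl ?_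
      intro z hz
      refine ⟨by simpa using (hSn z hz).le, fun i _ => ⟨hε.le.trans (hz i).1, ?_⟩⟩
      have := (hz i).2
      nlinarith [hSd z hz, norm_nonneg z.1, sq_nonneg ‖z.1‖]
    have hΨc : ContinuousOn Ψ S := by
      apply ContinuousOn.sub
      · apply ContinuousOn.mul
        · apply ContinuousOn.mul continuousOn_const
          apply ContinuousOn.rpow_const (by fun_prop)
          intro z hz
          exact Or.inr hp.le
        · apply ContinuousOn.inv₀ (by fun_prop)
          intro z hz
          exact (pow_pos (hSd z hz) _).ne'
      · have hmap : ContinuousOn (fun z : E × (Fin (n + 1) → ℝ) => (z.1, fun j => z.2 j - ε)) S := by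
          fun_prop
        refine hcont.comp hmap ?_
        intro z hz
        exact ⟨hSn z hz, fun i => ⟨by simpa using (hz i).1, by
          have := (hz i).2
          simp only
          linarith⟩⟩
    have hmem : (x, fun j => y j + ε) ∈ S := fun i => ⟨by simpa using (hy i).1, hyε i⟩
    obtain ⟨z, hz, hzmin⟩ := hSc.exists_isMinOn ⟨_, hmem⟩ hΨc
    have hzd := hSd z hz
    have hzY : ∀ i, 0 < z.2 i := fun i => hε.trans_le (hz i).1
    have hprod : 0 < ∏ i, z.2 i := Finset.prod_pos fun i _ => hzY i
    have hnonneg : 0 ≤ Ψ z := by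
      by_cases h1 : ∃ i, z.2 i = ε
      · obtain ⟨i, hi⟩ := h1
        simp only [Ψ]
        rw [hzero z.1 (fun j => z.2 j - ε) i (by simp [hi])]
        have := Real.rpow_pos_of_pos hprod p
        simp only [sub_zero]
        positivity
      by_cases h2 : ∃ i, z.2 i = κ * (1 - ‖z.1‖ ^ 2)
      · obtain ⟨i, hi⟩ := h2
        simp only [Ψ]
        have hf := hface z.1 (fun j => z.2 j - ε) (hSn z hz)
          (fun i => ⟨by simpa using (hz i).1, by have := (hz i).2; linarith⟩) i
        set α := 1 - ‖z.1‖ ^ 2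
        have hα1 : α ≤ 1 := by simp only [α]; nlinarith [sq_nonneg ‖z.1‖]
        rw [Fin.prod_univ_succAbove _ i, hi, Real.mul_rpow (by positivity)
          (Finset.prod_nonneg fun j _ => (hzY _).le), Real.mul_rpow hκ.le hzd.le]
        have h3 : (∏ j, (z.2 (i.succAbove j) - ε)) ^ p ≤ (∏ j, z.2 (i.succAbove j)) ^ p := by
          apply Real.rpow_le_rpow _ _ hp.le
          · exact Finset.prod_nonneg fun j _ => by simpa using (hz _).1
          · exact Finset.prod_le_prod (fun j _ => by simpa using (hz _).1) fun j _ => by linarith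
        have h4 : α ≤ α ^ p := by
          calc α = α ^ (1:ℝ) := (Real.rpow_one α).symm
            _ ≤ α ^ p := Real.rpow_le_rpow_of_exponent_ge hzd hα1 hp1.le
        set P := (∏ j, z.2 (i.succAbove j)) ^ p
        have hP : 0 ≤ P := Real.rpow_nonneg (Finset.prod_nonneg fun j _ => (hzY _).le) _
        have h30 : 0 ≤ (∏ j, (z.2 (i.succAbove j) - ε)) ^ p :=
          Real.rpow_nonneg (Finset.prod_nonneg fun j _ => by simpa using (hz _).1) _
        have h5 : G * (∏ j, (z.2 (i.succAbove j) - ε)) ^ p / α ^ n ≤ s * (κ ^ p * α ^ p * P) * (α ^ (n + 1))⁻¹ := by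
          rw [← div_eq_mul_inv, div_le_div_iff₀ (by positivity) (by positivity)]
          calc G * (∏ j, (z.2 (i.succAbove j) - ε)) ^ p * α ^ (n + 1)
              ≤ (s * κ ^ p) * P * α ^ (n + 1) := by gcongr
            _ = s * κ ^ p * P * α * α ^ n := by ring
            _ ≤ s * κ ^ p * P * α ^ p * α ^ n := by
                have : 0 < κ ^ p := Real.rpow_pos_of_pos hκ p
                gcongr
            _ = _ := by ring
        linarith
      exfalso
      push Not at h1 h2
      have hinter : ∀ i, ε < z.2 i ∧ z.2 i < κ * (1 - ‖z.1‖ ^ 2) := fun i =>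
        ⟨lt_of_le_of_ne (hz i).1 (h1 i).symm, lt_of_le_of_ne (hz i).2 (h2 i)⟩
      refine core_interior hp hp1 hpd hδ hc hκ hκ1 hκΛ hs hK hε Φ hpde z.1 z.2 (hSn z hz) hinter ?_ ?_
      · intro v
        have hev : ∀ᶠ t in nhds (0:ℝ), (z.1 + t • v, z.2) ∈ S := by
          have : ∀ᶠ t in nhds (0:ℝ), ∀ i, z.2 i < κ * (1 - ‖z.1 + t • v‖ ^ 2) := by
            rw [eventually_all]
            intro i
            have hc0 : ContinuousAt (fun t : ℝ => κ * (1 - ‖z.1 + t • v‖ ^ 2)) 0 := by fun_prop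
            exact hc0.eventually (lt_mem_nhds (by simpa using (hinter i).2))
          filter_upwards [this] with t ht i
          exact ⟨(hz i).1, (ht i).le⟩
        filter_upwards [hev] with t ht
        have := hzmin ht
        simpa [Ψ] using this
      · intro i
        have hev : ∀ᶠ t in nhds (0:ℝ), (z.1, z.2 + t • (Pi.single i (1:ℝ) : Fin (n + 1) → ℝ)) ∈ S := by
          have : ∀ᶠ t in nhds (0:ℝ), ∀ j, ε < (z.2 + t • (Pi.single i (1:ℝ) : Fin (n + 1) → ℝ)) j ∧
              (z.2 + t • (Pi.single i (1:ℝ) : Fin (n + 1) → ℝ)) j < κ * (1 - ‖z.1‖ ^ 2) := by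
            rw [eventually_all]
            intro j
            have hc0 : ContinuousAt (fun t : ℝ => (z.2 + t • (Pi.single i (1:ℝ) : Fin (n + 1) → ℝ)) j) 0 := by
              simp only [Pi.add_apply, Pi.smul_apply]
              fun_prop
            exact (hc0.eventually (lt_mem_nhds (by simpa using (hinter j).1))).and
              (hc0.eventually (gt_mem_nhds (by simpa using (hinter j).2)))
          filter_upwards [this] with t ht i
          exact ⟨(ht i).1.le, (ht i).2.le⟩
        filter_upwards [hev] with t ht
        have := hzmin ht
        have e : (fun j => (z.2 + t • (Pi.single i (1:ℝ) : Fin (n + 1) → ℝ)) j - ε) =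
          (fun j => z.2 j - ε) + t • (Pi.single i (1:ℝ) : Fin (n + 1) → ℝ) := by
          funext j; simp; ring
        simp only [Ψ, mem_setOf_eq] at this
        rw [e] at this
        simpa using this
    have h := hnonneg.trans (hzmin hmem)
    simp only [Ψ, add_sub_cancel_right, sub_nonneg] at h
    exact h
  have hlim : Tendsto (fun ε : ℝ => s * (∏ i, (y i + ε)) ^ p * ((1 - ‖x‖ ^ 2) ^ (n + 1))⁻¹)
      (nhdsWithin 0 (Ioi 0)) (nhds (s * (∏ i, (y i + 0)) ^ p * ((1 - ‖x‖ ^ 2) ^ (n + 1))⁻¹)) := by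
    refine Tendsto.mono_left ?_ nhdsWithin_le_nhds
    have : ContinuousAt (fun ε : ℝ => s * (∏ i, (y i + ε)) ^ p * ((1 - ‖x‖ ^ 2) ^ (n + 1))⁻¹) 0 := by
      apply ContinuousAt.mul _ continuousAt_const
      apply ContinuousAt.mul continuousAt_const
      apply ContinuousAt.rpow_const (by fun_prop) (Or.inr hp.le)
    exact this.tendsto
  have hev : ∀ᶠ ε in nhdsWithin (0:ℝ) (Ioi 0), Φ x y ≤
      s * (∏ i, (y i + ε)) ^ p * ((1 - ‖x‖ ^ 2) ^ (n + 1))⁻¹ := by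
    have : ∀ᶠ t in nhds (0:ℝ), ∀ i, y i + t < κ * (1 - ‖x‖ ^ 2) := by
      rw [eventually_all]
      intro i
      have hc0 : ContinuousAt (fun t : ℝ => y i + t) 0 := by fun_prop
      exact hc0.eventually (gt_mem_nhds (by simpa using (hy i).2))
    filter_upwards [nhdsWithin_le_nhds this, self_mem_nhdsWithin] with ε h1 h2
    exact key ε h2 fun i => (h1 i).le
  have := ge_of_tendsto hlim hev
  simpa [div_eq_mul_inv] using this

/-- sign of a boolean -/
def sg (b : Bool) : ℝ := if b then 1 else -1

lemma sg_not (b : Bool) : sg (!b) = - sg b := by cases b <;> simp [sg]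
lemma sg_sq (b : Bool) : sg b * sg b = 1 := by cases b <;> simp [sg]
lemma abs_sg (b : Bool) : |sg b| = 1 := by cases b <;> simp [sg]

/-- flip a sign -/
def flipB {m : ℕ} (i : Fin m) (σ : Fin m → Bool) : Fin m → Bool := Function.update σ i (!σ i)

lemma flipB_invol {m : ℕ} (i : Fin m) : Function.Involutive (flipB i) := by
  intro σ
  simp [flipB]

lemma prod_sg_flip {m : ℕ} (i : Fin m) (σ : Fin m → Bool) :
    ∏ j, sg (flipB i σ j) = - ∏ j, sg (σ j) := by
  rw [← Finset.mul_prod_erase _ _ (Finset.mem_univ i),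
    ← Finset.mul_prod_erase _ (fun j => sg (σ j)) (Finset.mem_univ i), ← neg_mul]
  congr 1
  · simp [flipB, sg_not]
  · apply Finset.prod_congr rfl
    intro j hj
    simp [flipB, Finset.ne_of_mem_erase hj]

lemma alt_bound {m : ℕ} (F : (Fin m → Bool) → ℝ) (i : Fin m) (B : ℝ)
    (h : ∀ σ, |F σ - F (flipB i σ)| ≤ B) :
    |∑ σ, (∏ j, sg (σ j)) * F σ| ≤ 2 ^ m * B := by
  have h1 : ∑ σ, (∏ j, sg (σ j)) * F σ = - ∑ σ, (∏ j, sg (σ j)) * F (flipB i σ) := by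
    rw [← Equiv.sum_comp (flipB_invol i).toPerm]
    simp only [Function.Involutive.coe_toPerm, prod_sg_flip, neg_mul, Finset.sum_neg_distrib]
  have h2 : 2 * ∑ σ, (∏ j, sg (σ j)) * F σ = ∑ σ, (∏ j, sg (σ j)) * (F σ - F (flipB i σ)) := by
    simp only [mul_sub, Finset.sum_sub_distrib]
    linarith
  have h3 : |∑ σ, (∏ j, sg (σ j)) * (F σ - F (flipB i σ))| ≤ 2 ^ m * B := by
    refine (Finset.abs_sum_le_sum_abs _ _).trans ?_
    calc ∑ σ : Fin m → Bool, |(∏ j, sg (σ j)) * (F σ - F (flipB i σ))| ≤ ∑ σ : Fin m → Bool, B := by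
          apply Finset.sum_le_sum
          intro σ _
          rw [abs_mul, Finset.abs_prod]
          simpa [abs_sg] using h σ
      _ = 2 ^ m * B := by simp
  rw [← h2, abs_mul, abs_two] at h3
  nlinarith [abs_nonneg (∑ σ, (∏ j, sg (σ j)) * F σ)]

/-- displacement -/
def disp {E : Type*} [AddCommGroup E] [Module ℝ E] {m : ℕ} (e : Fin m → E) (y : Fin m → ℝ)
    (σ : Fin m → Bool) : E := ∑ i, (sg (σ i) * y i) • e i

/-- iterated symmetric difference -/
def dif {E : Type*} [AddCommGroup E] [Module ℝ E] (u : E → ℝ) {m : ℕ} (e : Fin m → E) (x : E)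
    (y : Fin m → ℝ) : ℝ :=
  ∑ σ : Fin m → Bool, (∏ i, sg (σ i)) * u (x + disp e y σ)

section
variable {E : Type*} [NormedAddCommGroup E] [InnerProductSpace ℝ E]

lemma disp_flip {m : ℕ} (e : Fin m → E) (y : Fin m → ℝ) (i : Fin m) (σ : Fin m → Bool) :
    disp e y σ - disp e y (flipB i σ) = (2 * sg (σ i) * y i) • e i := by
  unfold disp
  rw [← Finset.add_sum_erase _ _ (Finset.mem_univ i),
    ← Finset.add_sum_erase _ (fun j => (sg (flipB i σ j) * y j) • e j) (Finset.mem_univ i)]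
  have : ∑ j ∈ Finset.univ.erase i, (sg (flipB i σ j) * y j) • e j =
      ∑ j ∈ Finset.univ.erase i, (sg (σ j) * y j) • e j := by
    apply Finset.sum_congr rfl
    intro j hj
    simp [flipB, Finset.ne_of_mem_erase hj]
  rw [this]
  simp only [flipB, Function.update_self, sg_not]
  module

lemma dif_zero (u : E → ℝ) {m : ℕ} (e : Fin m → E) (x : E) (y : Fin m → ℝ) (i : Fin m)
    (hi : y i = 0) : dif u e x y = 0 := by
  have := alt_bound (fun σ => u (x + disp e y σ)) i 0 (fun σ => by
    have h := disp_flip e y i σ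
    rw [hi] at h
    simp only [mul_zero, zero_smul, sub_eq_zero] at h
    simp only [h]
    simp)
  simpa [dif] using this

lemma norm_disp_le {m : ℕ} (e : Fin m → E) (he : ∀ i, ‖e i‖ ≤ 1) (y : Fin m → ℝ)
    {r : ℝ} (hy : ∀ i, 0 ≤ y i ∧ y i ≤ r) (σ : Fin m → Bool) : ‖disp e y σ‖ ≤ m * r := by
  unfold disp
  refine (norm_sum_le _ _).trans ?_
  calc ∑ i, ‖(sg (σ i) * y i) • e i‖ ≤ ∑ i : Fin m, r := by
        apply Finset.sum_le_sum
        intro i _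
        rw [norm_smul, Real.norm_eq_abs, abs_mul, abs_sg, one_mul, abs_of_nonneg (hy i).1]
        nlinarith [hy i, he i, norm_nonneg (e i)]
    _ = m * r := by simp

lemma dif_succ (u : E → ℝ) {m : ℕ} (e : Fin (m + 1) → E) (x : E) (y : Fin (m + 1) → ℝ)
    (i : Fin (m + 1)) :
    dif u e x y = dif u (fun j => e (i.succAbove j)) (x + y i • e i) (fun j => y (i.succAbove j)) -
      dif u (fun j => e (i.succAbove j)) (x - y i • e i) (fun j => y (i.succAbove j)) := by
  unfold dif
  rw [← Equiv.sum_comp (Fin.insertNthEquiv (fun _ => Bool) i), Fintype.sum_prod_type,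
    Fintype.sum_bool, sub_eq_add_neg, ← Finset.sum_neg_distrib]
  congr 1
  · apply Finset.sum_congr rfl
    intro σ _
    simp only [disp, Fin.insertNthEquiv_apply, Fin.prod_univ_succAbove _ i,
      Fin.sum_univ_succAbove _ i, Fin.insertNth_apply_same, Fin.insertNth_apply_succAbove]
    simp [sg, add_assoc]
  · apply Finset.sum_congr rfl
    intro σ _
    simp only [disp, Fin.insertNthEquiv_apply, Fin.prod_univ_succAbove _ i,
      Fin.sum_univ_succAbove _ i, Fin.insertNth_apply_same, Fin.insertNth_apply_succAbove]
    simp [sg, sub_eq_add_neg, add_assoc]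

lemma hasSD_line {u : E → ℝ} (hu : ContDiffOn ℝ 2 u (ball 0 1)) {z : E} (hz : z ∈ ball (0:E) 1)
    (v : E) : HasSD (fun t => u (z + t • v)) (fderiv ℝ (fderiv ℝ u) z v v) := by
  have hline : ∀ t : ℝ, HasDerivAt (fun t : ℝ => z + t • v) v t := by
    intro t
    simpa using ((hasDerivAt_id t).smul_const v).const_add z
  have hev : ∀ᶠ t in nhds (0:ℝ), z + t • v ∈ ball (0:E) 1 := by
    have : ContinuousAt (fun t : ℝ => z + t • v) 0 := by fun_prop
    exact this.eventually (isOpen_ball.mem_nhds (by simpa using hz))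
  refine ⟨fun t => fderiv ℝ u (z + t • v) v, ?_, ?_⟩
  · filter_upwards [hev] with t ht
    have h1 : DifferentiableAt ℝ u (z + t • v) :=
      (hu.differentiableOn (by norm_num)).differentiableAt (isOpen_ball.mem_nhds ht)
    exact h1.hasFDerivAt.comp_hasDerivAt t (hline t)
  · have h1 : ContDiffOn ℝ 1 (fderiv ℝ u) (ball 0 1) :=
      hu.fderiv_of_isOpen isOpen_ball (by norm_num)
    have h2 : DifferentiableAt ℝ (fderiv ℝ u) z :=
      (h1.differentiableOn (by norm_num)).differentiableAt (isOpen_ball.mem_nhds hz)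
    have h3 : HasFDerivAt (fderiv ℝ u) (fderiv ℝ (fderiv ℝ u) z) (z + (0:ℝ) • v) := by
      simpa using h2.hasFDerivAt
    have h4 := h3.comp_hasDerivAt (0:ℝ) (hline 0)
    have h5 := h4.clm_apply (hasDerivAt_const (0:ℝ) v)
    simpa using h5

lemma dif_hasSD_x {u : E → ℝ} (hu : ContDiffOn ℝ 2 u (ball 0 1)) {m : ℕ} (e : Fin m → E) (x : E)
    (y : Fin m → ℝ) (hz : ∀ σ, x + disp e y σ ∈ ball (0:E) 1) (v : E) :
    HasSD (fun t => dif u e (x + t • v) y) (∑ σ : Fin m → Bool, (∏ i, sg (σ i)) *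
      fderiv ℝ (fderiv ℝ u) (x + disp e y σ) v v) := by
  unfold dif
  apply HasSD.sum
  intro σ _
  have := (hasSD_line hu (hz σ) v).const_mul (∏ i, sg (σ i))
  have e1 : ∀ t : ℝ, x + t • v + disp e y σ = x + disp e y σ + t • v := fun t => by abel
  simp only [e1]
  exact this

lemma dif_hasSD_y {u : E → ℝ} (hu : ContDiffOn ℝ 2 u (ball 0 1)) {m : ℕ} (e : Fin m → E) (x : E)
    (y : Fin m → ℝ) (hz : ∀ σ, x + disp e y σ ∈ ball (0:E) 1) (i : Fin m) :
    HasSD (fun t => dif u e x (y + t • Pi.single i 1)) (∑ σ : Fin m → Bool, (∏ i, sg (σ i)) *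
      fderiv ℝ (fderiv ℝ u) (x + disp e y σ) (e i) (e i)) := by
  unfold dif
  apply HasSD.sum
  intro σ _
  have := (hasSD_line hu (hz σ) (sg (σ i) • e i)).const_mul (∏ i, sg (σ i))
  convert this using 2 with t
  · congr 2
    unfold disp
    have : ∀ j, (sg (σ j) * (y + t • (Pi.single i 1 : Fin m → ℝ)) j) • e j = (sg (σ j) * y j) • e j +
        (if j = i then t • sg (σ i) • e i else 0) := by
      intro j
      by_cases h : j = i
      · subst h
        simp
        module
      · simp [h]
    simp only [this, Finset.sum_add_distrib]
    simp [add_assoc]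
  · simp [← mul_assoc, sg_sq]

lemma dif_continuousOn {u : E → ℝ} (hu : ContinuousOn u (ball 0 1)) {m : ℕ} (e : Fin m → E)
    (S : Set (E × (Fin m → ℝ))) (hS : ∀ z ∈ S, ∀ σ, z.1 + disp e z.2 σ ∈ ball (0:E) 1) :
    ContinuousOn (fun z : E × (Fin m → ℝ) => dif u e z.1 z.2) S := by
  unfold dif
  apply continuousOn_finsetSum
  intro σ _
  apply ContinuousOn.mul continuousOn_const
  have h1 : ContinuousOn (fun z : E × (Fin m → ℝ) => z.1 + disp e z.2 σ) S := by
    unfold disp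
    fun_prop
  exact hu.comp h1 fun z hz => hS z hz σ

end

open scoped MatrixOrder Matrix.Norms.L2Operator in
lemma psd_factor {d : ℕ} {S : Matrix (Fin d) (Fin d) ℝ} (h : S.PosSemidef) :
    ∃ R : Matrix (Fin d) (Fin d) ℝ, S = R.conjTranspose * R := by
  have h0 : 0 ≤ S := Matrix.nonneg_iff_posSemidef.mpr h
  exact CStarAlgebra.nonneg_iff_eq_star_mul_self.mp h0

lemma bil_expand {d : ℕ} (B : EuclideanSpace ℝ (Fin d) →L[ℝ] EuclideanSpace ℝ (Fin d) →L[ℝ] ℝ)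
    (v w : EuclideanSpace ℝ (Fin d)) :
    B v w = ∑ i, ∑ j, v i * w j * B (EuclideanSpace.single i 1) (EuclideanSpace.single j 1) := by
  have hv : ∀ v : EuclideanSpace ℝ (Fin d), v = ∑ i, v i • EuclideanSpace.single i (1:ℝ) := by
    intro v
    ext k
    simp [Finset.sum_apply, Pi.single_apply]
  conv_lhs => rw [hv v, hv w]
  simp only [map_sum, map_smul, ContinuousLinearMap.sum_apply, ContinuousLinearMap.smul_apply,
    smul_eq_mul, Finset.mul_sum]
  rw [Finset.sum_comm]
  apply Finset.sum_congr rfl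
  intro i _
  apply Finset.sum_congr rfl
  intro j _
  ring

lemma decomp {d m : ℕ} {ν : ℝ} (hν : 0 < ν) (A : Fin d → Fin d → ℝ) (hsymm : ∀ i j, A i j = A j i)
    (hell : ∀ ξ : Fin d → ℝ, ν * ∑ i, ξ i ^ 2 ≤ ∑ i, ∑ j, A i j * ξ i * ξ j ∧
      ∑ i, ∑ j, A i j * ξ i * ξ j ≤ ν⁻¹ * ∑ i, ξ i ^ 2)
    (e : Fin m → EuclideanSpace ℝ (Fin d)) (he : ∀ i, ‖e i‖ ≤ 1) :
    ∃ v : Fin d → EuclideanSpace ℝ (Fin d), ∑ l, ‖v l‖ ^ 2 ≤ d * ν⁻¹ ∧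
      ∀ B : EuclideanSpace ℝ (Fin d) →L[ℝ] EuclideanSpace ℝ (Fin d) →L[ℝ] ℝ,
        ∑ i, ∑ j, A i j * B (EuclideanSpace.single i 1) (EuclideanSpace.single j 1) =
          ∑ l, B (v l) (v l) + (ν / (m + 1)) * ∑ k, B (e k) (e k) := by
  set c := ν / ((m:ℝ) + 1) with hc
  have hcpos : 0 < c := by positivity
  let S : Matrix (Fin d) (Fin d) ℝ := fun i j => A i j - c * ∑ k, e k i * e k j
  have hquad : ∀ ξ : Fin d → ℝ, 0 ≤ ∑ i, ∑ j, S i j * ξ i * ξ j := by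
    intro ξ
    have h1 : ∑ i, ∑ j, S i j * ξ i * ξ j = ∑ i, ∑ j, A i j * ξ i * ξ j -
        c * ∑ k, (∑ i, e k i * ξ i) ^ 2 := by
      have h2 : ∀ k, (∑ i, e k i * ξ i) ^ 2 = ∑ i, ∑ j, e k i * e k j * ξ i * ξ j := by
        intro k
        rw [sq, Finset.sum_mul_sum]
        apply Finset.sum_congr rfl; intro i _
        apply Finset.sum_congr rfl; intro j _
        ring
      simp only [h2]
      rw [Finset.sum_comm, Finset.mul_sum]
      conv_rhs => rw [Finset.sum_comm]
      simp only [S, sub_mul, Finset.sum_sub_distrib]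
      congr 1
      rw [Finset.sum_comm]
      simp only [Finset.mul_sum, Finset.sum_mul]
      rw [Finset.sum_comm' (t' := Finset.univ) (s' := fun _ => Finset.univ) (by simp)]
      conv_rhs => rw [Finset.sum_comm]
      rw [Finset.sum_comm]
      apply Finset.sum_congr rfl; intro i _
      conv_rhs => rw [Finset.sum_comm]
      apply Finset.sum_congr rfl; intro j _
      apply Finset.sum_congr rfl; intro k _
      ring
    have h3 : ∀ k, (∑ i, e k i * ξ i) ^ 2 ≤ ∑ i, ξ i ^ 2 := by
      intro k
      have hcs := Finset.sum_mul_sq_le_sq_mul_sq Finset.univ (fun i => e k i) ξ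
      have hn : ∑ i, (e k i) ^ 2 ≤ 1 := by
        have := EuclideanSpace.norm_sq_eq (e k)
        simp only [Real.norm_eq_abs, sq_abs] at this
        rw [← this]
        nlinarith [he k, norm_nonneg (e k)]
      have h0 : 0 ≤ ∑ i, ξ i ^ 2 := Finset.sum_nonneg fun i _ => sq_nonneg _
      nlinarith
    have h4 : ∑ k : Fin m, (∑ i, e k i * ξ i) ^ 2 ≤ m * ∑ i, ξ i ^ 2 := by
      calc _ ≤ ∑ k : Fin m, ∑ i, ξ i ^ 2 := Finset.sum_le_sum fun k _ => h3 k
        _ = _ := by simp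
    have h0 : 0 ≤ ∑ i, ξ i ^ 2 := Finset.sum_nonneg fun i _ => sq_nonneg _
    have h5 : c * m ≤ ν := by
      rw [hc, div_mul_eq_mul_div, div_le_iff₀ (by positivity)]
      nlinarith
    rw [h1]
    nlinarith [(hell ξ).1, mul_le_mul_of_nonneg_left h4 hcpos.le, mul_le_mul_of_nonneg_right h5 h0]
  have hpsd : S.PosSemidef := by
    refine Matrix.PosSemidef.of_dotProduct_mulVec_nonneg ?_ ?_
    · refine Matrix.IsHermitian.ext fun i j => ?_
      rw [star_trivial]
      change A j i - c * ∑ k, e k j * e k i = A i j - c * ∑ k, e k i * e k j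
      rw [hsymm j i]
      simp only [mul_comm]
    · intro ξ
      have h := hquad ξ
      have h2 : dotProduct (star ξ) (S.mulVec ξ) = ∑ i, ∑ j, S i j * ξ i * ξ j := by
        simp only [dotProduct, Matrix.mulVec, Finset.mul_sum]
        apply Finset.sum_congr rfl; intro i _
        apply Finset.sum_congr rfl; intro j _
        simp only [Pi.star_apply, star_trivial]
        ring
      rw [h2]
      exact h
  obtain ⟨R, hR⟩ := psd_factor hpsd
  have hS : ∀ i j, S i j = ∑ l, R l i * R l j := by
    intro i j
    rw [hR]
    simp [Matrix.mul_apply]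
  refine ⟨fun l => WithLp.toLp 2 (R l), ?_, ?_⟩
  · have h1 : ∑ l, ‖(WithLp.toLp 2 (R l) : EuclideanSpace ℝ (Fin d))‖ ^ 2 = ∑ i, S i i := by
      simp only [EuclideanSpace.norm_sq_eq, Real.norm_eq_abs, sq_abs, hS]
      rw [Finset.sum_comm]
      apply Finset.sum_congr rfl; intro i _
      apply Finset.sum_congr rfl; intro j _
      ring
    rw [h1]
    have h2 : ∀ i, S i i ≤ ν⁻¹ := by
      intro i
      have h3 := (hell (Pi.single i 1)).2
      have h4 : ∑ k : Fin d, ∑ j, A k j * (Pi.single i 1 : Fin d → ℝ) k * (Pi.single i 1 : Fin d → ℝ) j = A i i := by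
        simp [Pi.single_apply]
      have h5 : ∑ k : Fin d, (Pi.single i 1 : Fin d → ℝ) k ^ 2 = 1 := by
        simp [Pi.single_apply]
      rw [h4, h5] at h3
      have h6 : 0 ≤ c * ∑ k, e k i * e k i :=
        mul_nonneg hcpos.le (Finset.sum_nonneg fun k _ => mul_self_nonneg _)
      simp only [S]
      linarith
    calc ∑ i, S i i ≤ ∑ i : Fin d, ν⁻¹ := Finset.sum_le_sum fun i _ => h2 i
      _ = _ := by simp
  · intro B
    have hA : ∀ i j, A i j = ∑ l, R l i * R l j + c * ∑ k, e k i * e k j := by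
      intro i j
      rw [← hS]; simp [S]
    simp only [bil_expand B (WithLp.toLp 2 (R _)), bil_expand B (e _)]
    simp only [hA, add_mul, Finset.sum_add_distrib]
    congr 1
    · rw [Finset.sum_comm' (t' := Finset.univ) (s' := fun _ => Finset.univ) (by simp)]
      conv_rhs => rw [Finset.sum_comm]
      rw [Finset.sum_comm]
      apply Finset.sum_congr rfl; intro i _
      conv_rhs => rw [Finset.sum_comm]
      apply Finset.sum_congr rfl; intro j _
      rw [Finset.sum_mul]
    · conv_rhs => rw [Finset.sum_comm]
      rw [Finset.mul_sum]
      apply Finset.sum_congr rfl; intro i _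
      conv_rhs => rw [Finset.sum_comm]
      rw [Finset.mul_sum]
      apply Finset.sum_congr rfl; intro j _
      rw [mul_assoc, Finset.sum_mul]

/-- The reduced hypotheses. -/
structure GoodS (d q : ℕ) (ν δ : ℝ) (u : EuclideanSpace ℝ (Fin d) → ℝ) (T : ℝ) : Prop where
  cd : ContDiffOn ℝ 2 u (ball 0 1)
  pos : 0 < T
  bd : ∀ x ∈ ball (0 : EuclideanSpace ℝ (Fin d)) 1, |u x| ≤ T
  slice : ∀ x ∈ ball (0 : EuclideanSpace ℝ (Fin d)) 1, ∃ A : Fin d → Fin d → ℝ,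
    (∀ i j, A i j = A j i) ∧
    (∀ ξ : Fin d → ℝ, ν * ∑ i, ξ i ^ 2 ≤ ∑ i, ∑ j, A i j * ξ i * ξ j ∧
      ∑ i, ∑ j, A i j * ξ i * ξ j ≤ ν⁻¹ * ∑ i, ξ i ^ 2) ∧
    ∀ z ∈ ball (0 : EuclideanSpace ℝ (Fin d)) 1, ∀ w ∈ ball (0 : EuclideanSpace ℝ (Fin d)) 1,
      (∀ k : Fin d, q ≤ (k:ℕ) → z k = x k) → (∀ k : Fin d, q ≤ (k:ℕ) → w k = x k) →
      |∑ i, ∑ j, A i j * fderiv ℝ (fderiv ℝ u) z (EuclideanSpace.single i 1) (EuclideanSpace.single j 1)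
        - ∑ i, ∑ j, A i j * fderiv ℝ (fderiv ℝ u) w (EuclideanSpace.single i 1) (EuclideanSpace.single j 1)|
        ≤ T * ‖z - w‖ ^ δ

lemma ball_geom {E : Type*} [NormedAddCommGroup E] [InnerProductSpace ℝ E] {x v : E} (hx : ‖x‖ < 1)
    {r : ℝ} (hr : r ≤ 1 / 6) (hv : ‖v‖ ≤ r * (1 - ‖x‖ ^ 2)) :
    ‖x + v‖ < 1 ∧ (1 - ‖x‖ ^ 2) / 2 ≤ 1 - ‖x + v‖ ^ 2 := by
  have hα : 0 < 1 - ‖x‖ ^ 2 := by nlinarith [norm_nonneg x]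
  have h1 : ‖v‖ ≤ (1 - ‖x‖ ^ 2) / 6 := by nlinarith
  have h2 := norm_add_le x v
  have h3 : ‖x + v‖ < 1 := by nlinarith [norm_nonneg x]
  refine ⟨h3, ?_⟩
  have h4 : ‖x + v‖ ^ 2 ≤ (‖x‖ + ‖v‖) ^ 2 := pow_le_pow_left₀ (norm_nonneg _) h2 2
  nlinarith [norm_nonneg x, norm_nonneg v]

set_option maxHeartbeats 4000000 in
lemma main_ind (d q : ℕ) {ν δ : ℝ} (hν : 0 < ν) (hδ : 0 < δ) (hδ1 : δ < 1) (m : ℕ) (hm : m ≤ 3) :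
    ∃ κ C : ℝ, 0 < κ ∧ κ ≤ 1 / 18 ∧ 0 < C ∧
      ∀ u T, GoodS d q ν δ u T → ∀ e : Fin m → EuclideanSpace ℝ (Fin d),
        (∀ i, ‖e i‖ ≤ 1) → (∀ i, ∀ k : Fin d, q ≤ (k:ℕ) → e i k = 0) →
        ∀ x y, ‖x‖ < 1 → (∀ i, 0 ≤ y i ∧ y i < κ * (1 - ‖x‖ ^ 2)) →
          |dif u e x y| ≤ C * T * (∏ i, y i) ^ ((2 + δ) / 3) / (1 - ‖x‖ ^ 2) ^ m := by
  induction m with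
  | zero =>
    refine ⟨1 / 18, 1, by norm_num, le_rfl, by norm_num, ?_⟩
    intro u T hg e he het x y hx hy
    have := hg.bd x (by simpa using hx)
    simpa [dif, disp] using this
  | succ n ih =>
    obtain ⟨κ0, C0, hκ0, hκ0', hC0, H⟩ := ih (by omega)
    set p := (2 + δ) / 3 with hp
    have hp0 : 0 < p := by positivity
    have hp1 : p < 1 := by rw [hp]; linarith
    have hn2 : (n:ℝ) ≤ 2 := by exact_mod_cast (by omega : n ≤ 2)
    set c := ν / (((n + 1 : ℕ):ℝ) + 1) with hc
    have hc0 : 0 < c := by positivity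
    have hcp : 0 < c * p * (1 - p) := by
      have : 0 < 1 - p := by linarith
      positivity
    set L : ℝ := (4 * (n + 1) * (n + 2) + 2 * (n + 1)) * (d * ν⁻¹) with hL
    have hL0 : 0 ≤ L := by positivity
    set κ := min (κ0 / 4) (c * p * (1 - p) / 2 / (L + 1)) with hκ
    have hκpos : 0 < κ := lt_min (by positivity) (by positivity)
    have hκle : κ ≤ κ0 / 4 := min_le_left _ _
    have hκ1 : κ ≤ 1 / 18 := by linarith
    have hκL : κ ^ 2 * L ≤ c * p * (1 - p) / 2 := by
      have h1 : κ ≤ c * p * (1 - p) / 2 / (L + 1) := min_le_right _ _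
      rw [le_div_iff₀ (by positivity)] at h1
      nlinarith [mul_nonneg hκpos.le hL0]
    have hκp : 0 < κ ^ p := Real.rpow_pos_of_pos hκpos p
    set C := (2 * 2 ^ (n + 2) + 1) / (c * p * (1 - p)) + 2 * C0 * 2 ^ n / κ ^ p with hC
    refine ⟨κ, C, hκpos, hκ1, by positivity, ?_⟩
    intro u T hg e he het
    have hT := hg.pos
    have hin : ∀ x y, ‖x‖ < 1 → (∀ i, 0 ≤ y i ∧ y i ≤ κ * (1 - ‖x‖ ^ 2)) →
        ∀ σ, x + disp e y σ ∈ ball (0 : EuclideanSpace ℝ (Fin d)) 1 := by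
      intro x y hx hy σ
      have hα : 0 < 1 - ‖x‖ ^ 2 := by nlinarith [norm_nonneg x]
      have h1 := norm_disp_le e he y hy σ
      have h2 : ‖disp e y σ‖ ≤ (1 / 6) * (1 - ‖x‖ ^ 2) := by
        refine h1.trans ?_
        have : ((n + 1 : ℕ) : ℝ) ≤ 3 := by exact_mod_cast hm
        rw [← mul_assoc]
        gcongr
        nlinarith
      simpa using (ball_geom hx le_rfl h2).1
    have key : ∀ τ : ℝ, |τ| = 1 → ∀ x y, ‖x‖ < 1 → (∀ i, 0 ≤ y i ∧ y i < κ * (1 - ‖x‖ ^ 2)) →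
        τ * dif u e x y ≤ C * T * (∏ i, y i) ^ p / (1 - ‖x‖ ^ 2) ^ (n + 1) := by
      intro τ hτ x y hx hy
      refine core (D := d) (Λ := d * ν⁻¹) (c := c) (δ := δ) (K := 2 ^ (n + 2) * T)
        (G := 2 * C0 * T * 2 ^ n)
        hp0 hp1 ?_ hδ hc0 hκpos (by linarith) hκL ?_ (by positivity) (by positivity) ?_
        (fun x y => τ * dif u e x y) ?_ ?_ ?_ ?_ x y hx hy
      · have : ((n:ℝ) + 1) * p ≤ 3 * p := by gcongr; linarith
        rw [hp] at this ⊢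
        linarith
      · have : (2 * 2 ^ (n + 2) + 1) / (c * p * (1 - p)) ≤ C := by
          rw [hC]
          have : 0 ≤ 2 * C0 * 2 ^ n / κ ^ p := by positivity
          linarith
        rw [div_le_iff₀ hcp] at this
        nlinarith
      · have : 2 * C0 * 2 ^ n / κ ^ p ≤ C := by
          rw [hC]
          have : 0 ≤ (2 * 2 ^ (n + 2) + 1) / (c * p * (1 - p)) := by positivity
          linarith
        rw [div_le_iff₀ hκp] at this
        nlinarith
      · apply ContinuousOn.mul continuousOn_const
        apply dif_continuousOn hg.cd.continuousOn
        intro z hz σ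
        exact hin z.1 z.2 hz.1 hz.2 σ
      · intro x y i hi
        simp only [dif_zero u e x y i hi, mul_zero]
      · intro x y hx hy i
        have hα : 0 < 1 - ‖x‖ ^ 2 := by nlinarith [norm_nonneg x]
        have hbase : ∀ w : EuclideanSpace ℝ (Fin d), ‖w‖ ≤ κ * (1 - ‖x‖ ^ 2) →
            |dif u (fun j => e (i.succAbove j)) (x + w) (fun j => y (i.succAbove j))| ≤
              C0 * T * (∏ j, y (i.succAbove j)) ^ p * 2 ^ n / (1 - ‖x‖ ^ 2) ^ n := by
          intro w hw
          have hb := ball_geom hx (by linarith) hw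
          refine (H u T hg _ (fun j => he _) (fun j => het _) (x + w) _ hb.1 ?_).trans ?_
          · intro j
            refine ⟨(hy _).1, (hy _).2.trans_lt ?_⟩
            nlinarith
          · have hP : 0 ≤ (∏ j, y (i.succAbove j)) ^ p :=
              Real.rpow_nonneg (Finset.prod_nonneg fun j _ => (hy _).1) _
            have h5 : ((1 - ‖x‖ ^ 2) / 2) ^ n ≤ (1 - ‖x + w‖ ^ 2) ^ n :=
              pow_le_pow_left₀ (by positivity) hb.2 n
            calc _ ≤ C0 * T * (∏ j, y (i.succAbove j)) ^ p / ((1 - ‖x‖ ^ 2) / 2) ^ n := by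
                  gcongr
              _ = _ := by rw [div_pow]; field_simp
        have hw : ‖y i • e i‖ ≤ κ * (1 - ‖x‖ ^ 2) := by
          rw [norm_smul, Real.norm_eq_abs, abs_of_nonneg (hy i).1]
          nlinarith [hy i, he i, norm_nonneg (e i)]
        have h1 := hbase (y i • e i) hw
        have h2 := hbase (-(y i • e i)) (by rwa [norm_neg])
        rw [← sub_eq_add_neg] at h2
        have h3 : τ * dif u e x y ≤ |dif u e x y| := by
          have := le_abs_self (τ * dif u e x y)
          rwa [abs_mul, hτ, one_mul] at this
        refine h3.trans ?_
        rw [dif_succ u e x y i]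
        refine (abs_sub _ _).trans ?_
        calc _ ≤ C0 * T * (∏ j, y (i.succAbove j)) ^ p * 2 ^ n / (1 - ‖x‖ ^ 2) ^ n +
            C0 * T * (∏ j, y (i.succAbove j)) ^ p * 2 ^ n / (1 - ‖x‖ ^ 2) ^ n := add_le_add h1 h2
          _ = _ := by ring
      · intro x y hx hy
        have hz := hin x y hx (fun i => ⟨(hy i).1.le, (hy i).2.le⟩)
        obtain ⟨A, hA1, hA2, hA3⟩ := hg.slice x (by simpa using hx)
        obtain ⟨v, hv1, hv2⟩ := decomp hν A hA1 hA2 e he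
        refine ⟨v, _, _, hv1, fun l => (dif_hasSD_x hg.cd e x y hz (v l)).const_mul τ,
          fun i => (dif_hasSD_y hg.cd e x y hz i).const_mul τ, ?_⟩
        intro i
        have hsum : ∑ l, τ * ∑ σ : Fin (n + 1) → Bool, (∏ i, sg (σ i)) *
              fderiv ℝ (fderiv ℝ u) (x + disp e y σ) (v l) (v l) +
            c * ∑ k, τ * ∑ σ : Fin (n + 1) → Bool, (∏ i, sg (σ i)) *
              fderiv ℝ (fderiv ℝ u) (x + disp e y σ) (e k) (e k) =
            τ * ∑ σ : Fin (n + 1) → Bool, (∏ i, sg (σ i)) * (∑ i, ∑ j, A i j *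
              fderiv ℝ (fderiv ℝ u) (x + disp e y σ) (EuclideanSpace.single i 1)
                (EuclideanSpace.single j 1)) := by
          simp only [hv2, mul_add, Finset.sum_add_distrib, ← Finset.mul_sum]
          congr 1
          · rw [Finset.sum_comm]
            simp only [Finset.mul_sum]
          · rw [Finset.sum_comm]
            simp only [Finset.mul_sum]
            apply Finset.sum_congr rfl; intro σ _
            apply Finset.sum_congr rfl; intro k _
            rw [hc]
            ring
        rw [hsum]
        have hb := alt_bound (fun σ => ∑ i, ∑ j, A i j *
              fderiv ℝ (fderiv ℝ u) (x + disp e y σ) (EuclideanSpace.single i 1)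
                (EuclideanSpace.single j 1)) i (2 * T * y i ^ δ) (by
          intro σ
          have hk : ∀ σ, ∀ k : Fin d, q ≤ (k:ℕ) → (x + disp e y σ) k = x k := by
            intro σ k hk
            have : disp e y σ k = 0 := by
              unfold disp
              rw [WithLp.ofLp_sum, Finset.sum_apply]
              apply Finset.sum_eq_zero
              intro j _
              simp [het j k hk]
            simp [this]
          refine (hA3 _ (hz σ) _ (hz _) (hk _) (hk _)).trans ?_
          have h1 : ‖x + disp e y σ - (x + disp e y (flipB i σ))‖ ≤ 2 * y i := by
            rw [add_sub_add_left_eq_sub, disp_flip, norm_smul, Real.norm_eq_abs, abs_mul, abs_mul,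
              abs_sg, abs_two, abs_of_pos (hy i).1]
            nlinarith [hy i, he i, norm_nonneg (e i)]
          have h2 : ‖x + disp e y σ - (x + disp e y (flipB i σ))‖ ^ δ ≤ 2 * y i ^ δ := by
            calc _ ≤ (2 * y i) ^ δ := Real.rpow_le_rpow (norm_nonneg _) h1 hδ.le
              _ = 2 ^ δ * y i ^ δ := Real.mul_rpow (by norm_num) (hy i).1.le
              _ ≤ 2 ^ (1:ℝ) * y i ^ δ := by
                have : 0 ≤ y i ^ δ := Real.rpow_nonneg (hy i).1.le _
                gcongr
                norm_num
              _ = _ := by simp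
          nlinarith)
        set Z := ∑ σ : Fin (n + 1) → Bool, (∏ i, sg (σ i)) * (∑ i, ∑ j, A i j *
              fderiv ℝ (fderiv ℝ u) (x + disp e y σ) (EuclideanSpace.single i 1)
                (EuclideanSpace.single j 1))
        have h3 : -(τ * Z) ≤ |Z| := by
          have := neg_abs_le (τ * Z)
          rw [abs_mul, hτ, one_mul] at this
          linarith
        have h4 : (2:ℝ) ^ (n + 1) * (2 * T * y i ^ δ) = 2 ^ (n + 2) * T * y i ^ δ := by ring
        linarith
    intro x y hx hy
    rw [abs_le]
    constructor
    · have := key (-1) (by simp) x y hx hy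
      linarith
    · have := key 1 (by simp) x y hx hy
      linarith

lemma fd2_continuousOn {d : ℕ} {u : EuclideanSpace ℝ (Fin d) → ℝ} (hu : ContDiffOn ℝ 2 u (ball 0 1)) :
    ContinuousOn (fderiv ℝ (fderiv ℝ u)) (ball 0 1) := by
  have h1 : ContDiffOn ℝ 1 (fderiv ℝ u) (ball 0 1) :=
    hu.fderiv_of_isOpen isOpen_ball (by norm_num)
  exact h1.continuousOn_fderiv_of_isOpen isOpen_ball (by norm_num)

lemma pd2_eq_s1 {d : ℕ} {u : EuclideanSpace ℝ (Fin d) → ℝ} (hu : ContDiffOn ℝ 2 u (ball 0 1))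
    {z : EuclideanSpace ℝ (Fin d)} (hz : z ∈ ball (0 : EuclideanSpace ℝ (Fin d)) 1) (i j : Fin d) :
    pd2 i j u z = fderiv ℝ (fderiv ℝ u) z (EuclideanSpace.single i 1) (EuclideanSpace.single j 1) := by
  have h1 : ContDiffOn ℝ 1 (fderiv ℝ u) (ball 0 1) :=
    hu.fderiv_of_isOpen isOpen_ball (by norm_num)
  have h2 : DifferentiableAt ℝ (fderiv ℝ u) z :=
    (h1.differentiableOn (by norm_num)).differentiableAt (isOpen_ball.mem_nhds hz)
  unfold pd2 pd
  rw [fderiv_clm_apply h2 (differentiableAt_const _)]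
  simp

lemma entry_bound {d : ℕ} {ν : ℝ} (hν : 0 < ν) (A : Fin d → Fin d → ℝ) (hsymm : ∀ i j, A i j = A j i)
    (hell : ∀ ξ : Fin d → ℝ, ν * ∑ i, ξ i ^ 2 ≤ ∑ i, ∑ j, A i j * ξ i * ξ j ∧
      ∑ i, ∑ j, A i j * ξ i * ξ j ≤ ν⁻¹ * ∑ i, ξ i ^ 2) (i j : Fin d) : |A i j| ≤ ν⁻¹ := by
  have hdiag : ∀ i, A i i ≤ ν⁻¹ := by
    intro i
    have h3 := (hell (Pi.single i 1)).2
    have h4 : ∑ k : Fin d, ∑ j, A k j * (Pi.single i 1 : Fin d → ℝ) k * (Pi.single i 1 : Fin d → ℝ) j = A i i := by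
      simp [Pi.single_apply]
    have h5 : ∑ k : Fin d, (Pi.single i 1 : Fin d → ℝ) k ^ 2 = 1 := by
      simp [Pi.single_apply]
    rw [h4, h5] at h3
    linarith
  have hpos : ∀ ξ : Fin d → ℝ, 0 ≤ ∑ i, ∑ j, A i j * ξ i * ξ j := fun ξ =>
    le_trans (mul_nonneg hν.le (Finset.sum_nonneg fun i _ => sq_nonneg _)) (hell ξ).1
  have h1 := hpos (fun k => (Pi.single i 1 : Fin d → ℝ) k + (Pi.single j 1 : Fin d → ℝ) k)
  have h2 := hpos (fun k => (Pi.single i 1 : Fin d → ℝ) k - (Pi.single j 1 : Fin d → ℝ) k)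
  simp only [mul_add, add_mul, Finset.sum_add_distrib] at h1
  simp only [mul_sub, sub_mul, Finset.sum_sub_distrib] at h2
  simp [Pi.single_apply] at h1 h2
  have := hdiag i
  have := hdiag j
  have := hsymm i j
  rw [abs_le]
  constructor <;> linarith

lemma goodS_of {d q : ℕ} {ν δ : ℝ} (hν : 0 < ν) (hδ : 0 < δ)
    (a : Fin d → Fin d → EuclideanSpace ℝ (Fin d) → ℝ) (u f : EuclideanSpace ℝ (Fin d) → ℝ)
    (hsymm : ∀ i j x, a i j x = a j i x) (hell : UnifElliptic d ν a)
    (hind : ∀ i j (x y : EuclideanSpace ℝ (Fin d)),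
          (∀ k : Fin d, q ≤ (k : ℕ) → x k = y k) → a i j x = a i j y)
    (hu : ContDiffOn ℝ 2 u (ball (0 : EuclideanSpace ℝ (Fin d)) 1))
    (heq : ∀ᵐ x ∂(volume.restrict (ball (0 : EuclideanSpace ℝ (Fin d)) 1)),
          ∑ i, ∑ j, a i j x * pd2 i j u x = f x)
    {K M T : ℝ} (hf : PHolderX d q δ (ball (0 : EuclideanSpace ℝ (Fin d)) 1) f K)
    (hM : ∀ x ∈ ball (0 : EuclideanSpace ℝ (Fin d)) 1, |u x| ≤ M)
    (hT : 0 < T) (hKT : K ≤ T) (hMT : M ≤ T) : GoodS d q ν δ u T := by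
  refine ⟨hu, hT, fun x hx => (hM x hx).trans hMT, ?_⟩
  intro x0 hx0
  obtain ⟨S, hSV, hSc, hSd⟩ := (TopologicalSpace.IsSeparable.of_separableSpace
    {v : EuclideanSpace ℝ (Fin d) | ∀ k : Fin d, q ≤ (k:ℕ) → v k = 0}).exists_countable_dense_subset
  have hae : ∀ᵐ x ∂(volume : Measure (EuclideanSpace ℝ (Fin d))), ∀ τ ∈ S,
      x + τ ∈ ball (0 : EuclideanSpace ℝ (Fin d)) 1 →
        ∑ i, ∑ j, a i j (x + τ) * pd2 i j u (x + τ) = f (x + τ) := by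
    rw [ae_ball_iff hSc]
    intro τ _
    have h1 := (ae_restrict_iff' measurableSet_ball).mp heq
    exact (measurePreserving_add_right volume τ).quasiMeasurePreserving.ae h1
  have hdense := Measure.dense_of_ae hae
  obtain ⟨xs, hxs, hxl⟩ := mem_closure_iff_seq_limit.mp (hdense x0)
  have hbd : ∀ n, (fun i j => a i j (xs n)) ∈ closedBall (0 : Fin d → Fin d → ℝ) ν⁻¹ := by
    intro n
    have hν' : 0 ≤ ν⁻¹ := by positivity
    rw [mem_closedBall_zero_iff, pi_norm_le_iff_of_nonneg hν']
    intro i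
    rw [pi_norm_le_iff_of_nonneg hν']
    intro j
    exact entry_bound hν (fun i j => a i j (xs n)) (fun i j => hsymm i j _) (hell (xs n)) i j
  obtain ⟨A, -, φ, hφ, hA⟩ := tendsto_subseq_of_bounded isBounded_closedBall hbd
  have hxφ : Tendsto (fun n => xs (φ n)) atTop (nhds x0) := hxl.comp hφ.tendsto_atTop
  have hAij : ∀ i j, Tendsto (fun n => a i j (xs (φ n))) atTop (nhds (A i j)) := by
    intro i j
    exact (tendsto_pi_nhds.mp ((tendsto_pi_nhds.mp hA) i)) j
  have hquad : ∀ ξ : Fin d → ℝ, Tendsto (fun n => ∑ i, ∑ j, a i j (xs (φ n)) * ξ i * ξ j) atTop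
      (nhds (∑ i, ∑ j, A i j * ξ i * ξ j)) := by
    intro ξ
    apply tendsto_finsetSum; intro i _
    apply tendsto_finsetSum; intro j _
    exact ((hAij i j).mul_const _).mul_const _
  refine ⟨A, ?_, ?_, ?_⟩
  · intro i j
    refine tendsto_nhds_unique (hAij i j) ?_
    simpa only [hsymm i j] using hAij j i
  · intro ξ
    exact ⟨ge_of_tendsto' (hquad ξ) fun n => (hell _ ξ).1,
      le_of_tendsto' (hquad ξ) fun n => (hell _ ξ).2⟩
  · intro z hz w hw hzx hwx
    have hget : ∀ z ∈ ball (0 : EuclideanSpace ℝ (Fin d)) 1,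
        (∀ k : Fin d, q ≤ (k:ℕ) → z k = x0 k) → ∃ τ : ℕ → EuclideanSpace ℝ (Fin d),
        (∀ n, τ n ∈ S) ∧ Tendsto (fun n => xs (φ n) + τ n) atTop (nhds z) := by
      intro z hz hzx
      have hm : z - x0 ∈ closure S := hSd (by
        intro k hk
        simp [hzx k hk])
      obtain ⟨τ, hτ, hτl⟩ := mem_closure_iff_seq_limit.mp hm
      refine ⟨τ, hτ, ?_⟩
      have := hxφ.add hτl
      simpa using this
    obtain ⟨τ, hτS, hτ⟩ := hget z hz hzx
    obtain ⟨τ', hτS', hτ'⟩ := hget w hw hwx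
    have hlim : ∀ z ∈ ball (0 : EuclideanSpace ℝ (Fin d)) 1, ∀ τ : ℕ → EuclideanSpace ℝ (Fin d),
        Tendsto (fun n => xs (φ n) + τ n) atTop (nhds z) →
        Tendsto (fun n => ∑ i, ∑ j, a i j (xs (φ n)) * fderiv ℝ (fderiv ℝ u) (xs (φ n) + τ n)
          (EuclideanSpace.single i 1) (EuclideanSpace.single j 1)) atTop
          (nhds (∑ i, ∑ j, A i j * fderiv ℝ (fderiv ℝ u) z
          (EuclideanSpace.single i 1) (EuclideanSpace.single j 1))) := by
      intro z hz τ hτ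
      have hc : ContinuousAt (fderiv ℝ (fderiv ℝ u)) z :=
        (fd2_continuousOn hu).continuousAt (isOpen_ball.mem_nhds hz)
      have h1 := hc.tendsto.comp hτ
      apply tendsto_finsetSum; intro i _
      apply tendsto_finsetSum; intro j _
      refine (hAij i j).mul ?_
      have hcont : Continuous (fun B : EuclideanSpace ℝ (Fin d) →L[ℝ] EuclideanSpace ℝ (Fin d) →L[ℝ] ℝ =>
          B (EuclideanSpace.single i 1) (EuclideanSpace.single j 1)) := by fun_prop
      exact (hcont.tendsto _).comp h1
    have hL := ((hlim z hz τ hτ).sub (hlim w hw τ' hτ')).abs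
    have hR : Tendsto (fun n => T * ‖xs (φ n) + τ n - (xs (φ n) + τ' n)‖ ^ δ) atTop
        (nhds (T * ‖z - w‖ ^ δ)) :=
      (((hτ.sub hτ').norm).rpow_const (Or.inr hδ.le)).const_mul T
    refine le_of_tendsto_of_tendsto hL hR ?_
    filter_upwards [hτ.eventually (isOpen_ball.mem_nhds hz),
      hτ'.eventually (isOpen_ball.mem_nhds hw)] with n hn hn'
    have hval : ∀ σ ∈ S, xs (φ n) + σ ∈ ball (0 : EuclideanSpace ℝ (Fin d)) 1 →
        ∑ i, ∑ j, a i j (xs (φ n)) * fderiv ℝ (fderiv ℝ u) (xs (φ n) + σ)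
          (EuclideanSpace.single i 1) (EuclideanSpace.single j 1) = f (xs (φ n) + σ) := by
      intro σ hσ hb
      rw [← hxs (φ n) σ hσ hb]
      apply Finset.sum_congr rfl; intro i _
      apply Finset.sum_congr rfl; intro j _
      rw [pd2_eq_s1 hu hb, hind i j (xs (φ n) + σ) (xs (φ n))]
      intro k hk
      simp [hSV hσ k hk]
    rw [hval _ (hτS n) hn, hval _ (hτS' n) hn']
    have h1 := hf _ hn _ hn' (by
      intro k hk
      simp [hSV (hτS n) k hk, hSV (hτS' n) k hk])
    rw [dist_eq_norm] at h1
    refine h1.trans ?_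
    have : 0 ≤ ‖xs (φ n) + τ n - (xs (φ n) + τ' n)‖ ^ δ := Real.rpow_nonneg (norm_nonneg _) _
    nlinarith

section
variable {E : Type*} [NormedAddCommGroup E] [InnerProductSpace ℝ E]

lemma dif_three (u : E → ℝ) (e1 e2 e3 x : E) (y1 y2 y3 : ℝ) :
    dif u ![e1, e2, e3] x ![y1, y2, y3] =
      u (x + y1 • e1 + y2 • e2 + y3 • e3) - u (x + y1 • e1 + y2 • e2 - y3 • e3)
      - (u (x + y1 • e1 - y2 • e2 + y3 • e3) - u (x + y1 • e1 - y2 • e2 - y3 • e3))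
      - (u (x - y1 • e1 + y2 • e2 + y3 • e3) - u (x - y1 • e1 + y2 • e2 - y3 • e3)
      - (u (x - y1 • e1 - y2 • e2 + y3 • e3) - u (x - y1 • e1 - y2 • e2 - y3 • e3))) := by
  have h0 : ∀ (x : E) (e : Fin 0 → E) (y : Fin 0 → ℝ), dif u e x y = u x := by
    intro x e y
    simp [dif, disp]
  simp only [dif_succ u _ _ _ 0, h0]
  simp [Fin.succAbove]

lemma geom_step {r A : ℝ} (hr0 : 0 ≤ r) (hr1 : r < 1) (hA : 0 ≤ A) (Q : ℕ → ℝ) (h0 : |Q 0| ≤ A)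
    (hs : ∀ n, |Q n - Q (n + 1)| ≤ A * r ^ (n + 1)) (n : ℕ) : |Q n| ≤ A * (1 - r)⁻¹ := by
  have h1 : ∀ n, |Q n| ≤ A * ∑ k ∈ Finset.range (n + 1), r ^ k := by
    intro n
    induction n with
    | zero => simpa using h0
    | succ n ih =>
      rw [Finset.sum_range_succ, mul_add]
      have h2 := hs n
      have h3 : |Q (n + 1)| ≤ |Q n| + |Q n - Q (n + 1)| := by
        have := abs_sub (Q n) (Q n - Q (n + 1))
        simpa using this
      linarith
  refine (h1 n).trans ?_
  gcongr
  rw [geom_sum_eq (by linarith)]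
  rw [← neg_div_neg_eq, neg_sub, neg_sub, div_eq_mul_inv]
  have : 0 < (1 - r)⁻¹ := inv_pos.mpr (by linarith)
  have := pow_nonneg hr0 (n + 1)
  nlinarith
end

lemma third_diff (d q : ℕ) {ν δ : ℝ} (hν : 0 < ν) (hδ : 0 < δ) (hδ1 : δ < 1) :
    ∃ h0 C : ℝ, 0 < h0 ∧ h0 ≤ 1 / 18 ∧ 0 < C ∧
      ∀ u T, GoodS d q ν δ u T → ∀ e1 e2 e3 : EuclideanSpace ℝ (Fin d),
        ‖e1‖ ≤ 1 → ‖e2‖ ≤ 1 → ‖e3‖ ≤ 1 → (∀ k : Fin d, q ≤ (k:ℕ) → e1 k = 0) →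
        (∀ k : Fin d, q ≤ (k:ℕ) → e2 k = 0) → (∀ k : Fin d, q ≤ (k:ℕ) → e3 k = 0) →
        ∀ x y1 y2 y3 r, ‖x‖ ≤ 3 / 4 → 0 ≤ y1 → y1 ≤ r → 0 ≤ y2 → y2 ≤ r → 0 ≤ y3 → y3 ≤ r → r < h0 →
          |dif u ![e1, e2, e3] x ![y1, y2, y3]| ≤ C * T * r ^ (2 + δ) := by
  obtain ⟨κ, C, hκ, hκ', hC, H⟩ := main_ind d q hν hδ hδ1 3 le_rfl
  refine ⟨κ * (7 / 16), C / (7 / 16) ^ 3, by positivity, by linarith, by positivity, ?_⟩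
  intro u T hg e1 e2 e3 he1 he2 he3 ht1 ht2 ht3 x y1 y2 y3 r hx hy1 hr1 hy2 hr2 hy3 hr3 hr
  have hα : 7 / 16 ≤ 1 - ‖x‖ ^ 2 := by nlinarith [norm_nonneg x]
  have hκα : κ * (7 / 16) ≤ κ * (1 - ‖x‖ ^ 2) := by gcongr
  have h := H u T hg ![e1, e2, e3] (by
    intro i; fin_cases i <;> simpa) (by
    intro i k hk; fin_cases i
    · exact ht1 k hk
    · exact ht2 k hk
    · exact ht3 k hk) x ![y1, y2, y3] (by linarith) (by
    intro i; fin_cases i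
    · exact ⟨hy1, by simp only [Fin.zero_eta, Matrix.cons_val_zero]; linarith⟩
    · exact ⟨hy2, by simp only [Fin.mk_one, Matrix.cons_val_one, Matrix.cons_val_zero]; linarith⟩
    · exact ⟨hy3, by change y3 < _; linarith⟩)
  refine h.trans ?_
  have hT := hg.pos
  have hr0 : 0 ≤ r := hy1.trans hr1
  have hprod : ∏ i, (![y1, y2, y3] : Fin 3 → ℝ) i = y1 * y2 * y3 := by
    simp [Fin.prod_univ_three]
  rw [hprod]
  have h1 : (y1 * y2 * y3) ^ ((2 + δ) / 3) ≤ r ^ (2 + δ) := by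
    calc (y1 * y2 * y3) ^ ((2 + δ) / 3) ≤ (r * r * r) ^ ((2 + δ) / 3) := by
          apply Real.rpow_le_rpow (by positivity) _ (by positivity)
          gcongr
      _ = r ^ (2 + δ) := by
        rw [show r * r * r = r ^ (3:ℝ) by norm_cast; ring, ← Real.rpow_mul hr0]
        congr 1
        ring
  have h2 : (7 / 16 : ℝ) ^ 3 ≤ (1 - ‖x‖ ^ 2) ^ 3 := pow_le_pow_left₀ (by norm_num) hα 3
  have h3 : 0 ≤ r ^ (2 + δ) := Real.rpow_nonneg hr0 _
  calc _ ≤ C * T * r ^ (2 + δ) / (7 / 16) ^ 3 := by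
        apply div_le_div₀ (by positivity) _ (by norm_num) h2
        exact mul_le_mul_of_nonneg_left h1 (by positivity)
    _ = _ := by ring

lemma second_dir (d q : ℕ) {ν δ : ℝ} (hν : 0 < ν) (hδ : 0 < δ) (hδ1 : δ < 1) :
    ∃ h0 C : ℝ, 0 < h0 ∧ 0 < C ∧
      ∀ u T, GoodS d q ν δ u T → ∀ e e' : EuclideanSpace ℝ (Fin d),
        ‖e‖ ≤ 1 → ‖e'‖ ≤ 1 → (∀ k : Fin d, q ≤ (k:ℕ) → e k = 0) →
        (∀ k : Fin d, q ≤ (k:ℕ) → e' k = 0) →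
        ∀ c h, ‖c‖ ≤ 1 / 2 → 0 < h → h < h0 →
          |fderiv ℝ (fderiv ℝ u) (c + h • e) e' e' - fderiv ℝ (fderiv ℝ u) (c - h • e) e' e'|
            ≤ C * T * h ^ δ := by
  obtain ⟨h0, C, hh0, hh0', hC, H⟩ := third_diff d q hν hδ hδ1
  set r : ℝ := (2:ℝ) ^ (-δ) with hr
  have hr0 : 0 < r := by positivity
  have hr1 : r < 1 := Real.rpow_lt_one_of_one_lt_of_neg (by norm_num) (by linarith)
  have hinv : 0 < (1 - r)⁻¹ := inv_pos.mpr (by linarith)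
  refine ⟨h0, C * (1 - r)⁻¹, hh0, by positivity, ?_⟩
  intro u T hg e e' he he' het het' c h hc hh hhh
  have hT := hg.pos
  have hhe : ‖h • e‖ ≤ 1 / 18 := by
    rw [norm_smul, Real.norm_eq_abs, abs_of_pos hh]
    nlinarith [norm_nonneg e]
  have hp1 : ‖c + h • e‖ ≤ 1 / 2 + 1 / 18 := (norm_add_le _ _).trans (by linarith)
  have hp2 : ‖c - h • e‖ ≤ 1 / 2 + 1 / 18 := (norm_sub_le _ _).trans (by linarith)
  set g : ℝ → ℝ := fun t => u (c + h • e + t • e') - u (c - h • e + t • e') with hgdef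
  have hsd : HasSD g (fderiv ℝ (fderiv ℝ u) (c + h • e) e' e' -
      fderiv ℝ (fderiv ℝ u) (c - h • e) e' e') :=
    (hasSD_line hg.cd (by rw [mem_ball_zero_iff]; linarith) e').sub
      (hasSD_line hg.cd (by rw [mem_ball_zero_iff]; linarith) e')
  set G : ℝ → ℝ := fun t => g t - 2 * g 0 + g (-t) with hG
  -- bound at h
  have hG1 : |G h| ≤ C * T * h ^ (2 + δ) := by
    have h1 := H u T hg e' e' e he' he' he het' het' het c (h / 2) (h / 2) h h (by linarith)
      (by linarith) (by linarith) (by linarith) (by linarith) hh.le le_rfl hhh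
    rw [dif_three] at h1
    convert h1 using 2
    simp only [hG, hgdef]
    have e1 : c + (h / 2) • e' + (h / 2) • e' + h • e = c + h • e + h • e' := by module
    have e2 : c + (h / 2) • e' + (h / 2) • e' - h • e = c - h • e + h • e' := by module
    have e3 : c + (h / 2) • e' - (h / 2) • e' + h • e = c + h • e + (0:ℝ) • e' := by module
    have e4 : c + (h / 2) • e' - (h / 2) • e' - h • e = c - h • e + (0:ℝ) • e' := by module
    have e5 : c - (h / 2) • e' + (h / 2) • e' + h • e = c + h • e + (0:ℝ) • e' := by module
    have e6 : c - (h / 2) • e' + (h / 2) • e' - h • e = c - h • e + (0:ℝ) • e' := by module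
    have e7 : c - (h / 2) • e' - (h / 2) • e' + h • e = c + h • e + (-h) • e' := by module
    have e8 : c - (h / 2) • e' - (h / 2) • e' - h • e = c - h • e + (-h) • e' := by module
    rw [e1, e2, e3, e4, e5, e6, e7, e8]
    ring
  have hG2 : ∀ t, 0 < t → t < h0 → |G (2 * t) - 4 * G t| ≤ 4 * (C * T * t ^ (2 + δ)) := by
    intro t ht hth
    have hte : ‖(t / 2) • e'‖ ≤ 1 / 18 := by
      rw [norm_smul, Real.norm_eq_abs, abs_of_pos (by linarith)]
      nlinarith [norm_nonneg e']
    have hD : ∀ z : EuclideanSpace ℝ (Fin d), ‖z‖ ≤ 3 / 4 →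
        |u (z + (3 * t / 2) • e') - 3 * u (z + (t / 2) • e') + 3 * u (z - (t / 2) • e')
          - u (z - (3 * t / 2) • e')| ≤ C * T * t ^ (2 + δ) := by
      intro z hz
      have h1 := H u T hg e' e' e' he' he' he' het' het' het' z (t / 2) (t / 2) (t / 2) t hz
        (by linarith) (by linarith) (by linarith) (by linarith) (by linarith) (by linarith) hth
      rw [dif_three] at h1
      convert h1 using 2
      have e1 : z + (t / 2) • e' + (t / 2) • e' + (t / 2) • e' = z + (3 * t / 2) • e' := by module
      have e2 : z + (t / 2) • e' + (t / 2) • e' - (t / 2) • e' = z + (t / 2) • e' := by module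
      have e3 : z + (t / 2) • e' - (t / 2) • e' + (t / 2) • e' = z + (t / 2) • e' := by module
      have e4 : z + (t / 2) • e' - (t / 2) • e' - (t / 2) • e' = z - (t / 2) • e' := by module
      have e5 : z - (t / 2) • e' + (t / 2) • e' + (t / 2) • e' = z + (t / 2) • e' := by module
      have e6 : z - (t / 2) • e' + (t / 2) • e' - (t / 2) • e' = z - (t / 2) • e' := by module
      have e7 : z - (t / 2) • e' - (t / 2) • e' + (t / 2) • e' = z - (t / 2) • e' := by module
      have e8 : z - (t / 2) • e' - (t / 2) • e' - (t / 2) • e' = z - (3 * t / 2) • e' := by module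
      rw [e1, e2, e3, e4, e5, e6, e7, e8]
      ring
    have hF : ∀ b : EuclideanSpace ℝ (Fin d), ‖b‖ ≤ 1 / 2 + 1 / 18 →
        |u (b + (2 * t) • e') - 4 * u (b + t • e') + 6 * u (b + (0:ℝ) • e') - 4 * u (b + (-t) • e')
          + u (b + (-(2 * t)) • e')| ≤ 2 * (C * T * t ^ (2 + δ)) := by
      intro b hb
      have h1 := hD (b + (t / 2) • e') ((norm_add_le _ _).trans (by linarith))
      have h2 := hD (b - (t / 2) • e') ((norm_sub_le _ _).trans (by linarith))
      have e1 : b + (t / 2) • e' + (3 * t / 2) • e' = b + (2 * t) • e' := by module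
      have e2 : b + (t / 2) • e' + (t / 2) • e' = b + t • e' := by module
      have e3 : b + (t / 2) • e' - (t / 2) • e' = b + (0:ℝ) • e' := by module
      have e4 : b + (t / 2) • e' - (3 * t / 2) • e' = b + (-t) • e' := by module
      have e5 : b - (t / 2) • e' + (3 * t / 2) • e' = b + t • e' := by module
      have e6 : b - (t / 2) • e' + (t / 2) • e' = b + (0:ℝ) • e' := by module
      have e7 : b - (t / 2) • e' - (t / 2) • e' = b + (-t) • e' := by module
      have e8 : b - (t / 2) • e' - (3 * t / 2) • e' = b + (-(2 * t)) • e' := by module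
      rw [e1, e2, e3, e4] at h1
      rw [e5, e6, e7, e8] at h2
      rw [abs_le] at h1 h2 ⊢
      constructor <;> linarith [h1.1, h1.2, h2.1, h2.2]
    have h1 := hF _ hp1
    have h2 := hF _ hp2
    simp only [hG, hgdef]
    rw [abs_le] at h1 h2 ⊢
    constructor <;> linarith [h1.1, h1.2, h2.1, h2.2]
  set Q : ℕ → ℝ := fun n => G (h / 2 ^ n) / (h / 2 ^ n) ^ 2 with hQ
  have hpowadd : ∀ t : ℝ, 0 < t → t ^ (2 + δ) = t ^ 2 * t ^ δ := by
    intro t ht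
    rw [Real.rpow_add ht]
    norm_cast
  have hA : 0 ≤ C * T * h ^ δ := by positivity
  have hQ0 : |Q 0| ≤ C * T * h ^ δ := by
    simp only [hQ, pow_zero, div_one]
    rw [abs_div, abs_of_pos (by positivity : 0 < h ^ 2), div_le_iff₀ (by positivity)]
    refine hG1.trans (le_of_eq ?_)
    rw [hpowadd h hh]
    ring
  have hQs : ∀ n, |Q n - Q (n + 1)| ≤ C * T * h ^ δ * r ^ (n + 1) := by
    intro n
    set t := h / 2 ^ (n + 1) with ht
    have ht0 : 0 < t := by positivity
    have hth : t < h0 := by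
      refine lt_of_le_of_lt ?_ hhh
      exact div_le_self hh.le (one_le_pow₀ (by norm_num))
    have e1 : h / 2 ^ n = 2 * t := by rw [ht, pow_succ]; field_simp
    have e2 : t ^ δ = h ^ δ * r ^ (n + 1) := by
      rw [ht, Real.div_rpow hh.le (by positivity), hr, ← Real.rpow_natCast, ← Real.rpow_natCast,
        ← Real.rpow_mul (by norm_num), ← Real.rpow_mul (by norm_num), div_eq_mul_inv,
        ← Real.rpow_neg (by norm_num)]
      congr 2
      ring
    have e3 : Q n - Q (n + 1) = (G (2 * t) - 4 * G t) / (4 * t ^ 2) := by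
      simp only [hQ]
      rw [e1, ← ht]
      field_simp
      ring
    rw [e3, abs_div, abs_of_pos (by positivity : 0 < 4 * t ^ 2), div_le_iff₀ (by positivity)]
    refine (hG2 t ht0 hth).trans (le_of_eq ?_)
    rw [hpowadd t ht0, e2]
    ring
  have hQb := geom_step hr0.le hr1 hA Q hQ0 hQs
  have hseq : Tendsto (fun n : ℕ => h / 2 ^ n) atTop (nhdsWithin 0 (Ioi 0)) := by
    refine tendsto_nhdsWithin_iff.mpr ⟨?_, Eventually.of_forall fun n => ?_⟩
    · have := (tendsto_pow_atTop_nhds_zero_of_lt_one (r := (1/2:ℝ)) (by norm_num) (by norm_num)).const_mul h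
      simpa [div_eq_mul_inv] using this
    · exact div_pos hh (by positivity)
  have hlim := (hsd.tendsto.comp hseq).abs
  refine le_of_tendsto' hlim fun n => ?_
  calc _ = |Q n| := rfl
    _ ≤ C * T * h ^ δ * (1 - r)⁻¹ := hQb n
    _ = _ := by ring

lemma pd2_close (d q : ℕ) {ν δ : ℝ} (hν : 0 < ν) (hδ : 0 < δ) (hδ1 : δ < 1) :
    ∃ h0 C : ℝ, 0 < h0 ∧ 0 < C ∧
      ∀ u T, GoodS d q ν δ u T → ∀ i j : Fin d, (i:ℕ) < q → (j:ℕ) < q →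
        ∀ x ∈ ball (0 : EuclideanSpace ℝ (Fin d)) (1 / 2),
        ∀ y ∈ ball (0 : EuclideanSpace ℝ (Fin d)) (1 / 2),
        (∀ k : Fin d, q ≤ (k:ℕ) → x k = y k) → dist x y < h0 →
          |pd2 i j u x - pd2 i j u y| ≤ C * T * dist x y ^ δ := by
  obtain ⟨h0, C, hh0, hC, H⟩ := second_dir d q hν hδ hδ1
  refine ⟨h0, 2 * C, hh0, by positivity, ?_⟩
  intro u T hg i j hi hj x hx y hy hxy hd
  have hT := hg.pos
  rcases eq_or_ne x y with rfl | hne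
  · simp only [sub_self, abs_zero, dist_self]
    rw [Real.zero_rpow hδ.ne']
    simp
  have hx1 : x ∈ ball (0 : EuclideanSpace ℝ (Fin d)) 1 := ball_subset_ball (by norm_num) hx
  have hy1 : y ∈ ball (0 : EuclideanSpace ℝ (Fin d)) 1 := ball_subset_ball (by norm_num) hy
  rw [mem_ball_zero_iff] at hx hy
  rw [dist_eq_norm] at hd ⊢
  have hn : 0 < ‖x - y‖ := norm_pos_iff.mpr (sub_ne_zero.mpr hne)
  have hdir : ∀ e' : EuclideanSpace ℝ (Fin d), ‖e'‖ ≤ 1 → (∀ k : Fin d, q ≤ (k:ℕ) → e' k = 0) →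
      |fderiv ℝ (fderiv ℝ u) x e' e' - fderiv ℝ (fderiv ℝ u) y e' e'| ≤ C * T * ‖x - y‖ ^ δ := by
    intro e' he' het'
    have h1 := H u T hg (‖x - y‖⁻¹ • (x - y)) e' (by
      rw [norm_smul, norm_inv, norm_norm, inv_mul_cancel₀ hn.ne']) he' (by
      intro k hk
      simp [hxy k hk]) het' ((1/2:ℝ) • (x + y)) (‖x - y‖ / 2) (by
      rw [norm_smul]
      have := norm_add_le x y
      norm_num
      linarith) (by positivity) (by linarith)
    have e0 : (‖x - y‖ / 2) • (‖x - y‖⁻¹ • (x - y)) = (1/2:ℝ) • (x - y) := by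
      rw [smul_smul]
      congr 1
      field_simp
    have e1 : (1/2:ℝ) • (x + y) + (1/2:ℝ) • (x - y) = x := by module
    have e2 : (1/2:ℝ) • (x + y) - (1/2:ℝ) • (x - y) = y := by module
    rw [e0, e1, e2] at h1
    refine h1.trans ?_
    have : (‖x - y‖ / 2) ^ δ ≤ ‖x - y‖ ^ δ :=
      Real.rpow_le_rpow (by positivity) (by linarith) hδ.le
    gcongr
  have hpol : ∀ z ∈ ball (0 : EuclideanSpace ℝ (Fin d)) 1, pd2 i j u z =
      fderiv ℝ (fderiv ℝ u) z ((1/2:ℝ) • (EuclideanSpace.single i 1 + EuclideanSpace.single j 1))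
        ((1/2:ℝ) • (EuclideanSpace.single i 1 + EuclideanSpace.single j 1)) -
      fderiv ℝ (fderiv ℝ u) z ((1/2:ℝ) • (EuclideanSpace.single i 1 - EuclideanSpace.single j 1))
        ((1/2:ℝ) • (EuclideanSpace.single i 1 - EuclideanSpace.single j 1)) := by
    intro z hz
    rw [pd2_eq_s1 hg.cd hz]
    have hs : IsSymmSndFDerivAt ℝ u z :=
      (hg.cd.contDiffAt (isOpen_ball.mem_nhds hz)).isSymmSndFDerivAt (by simp)
    have := hs (EuclideanSpace.single i 1) (EuclideanSpace.single j 1)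
    simp only [map_smul, map_add, map_sub, smul_apply, add_apply,
      sub_apply, smul_eq_mul]
    linarith
  have hnorm : ∀ k : Fin d, ‖(EuclideanSpace.single k 1 : EuclideanSpace ℝ (Fin d))‖ = 1 := by
    intro k; simp
  have hz1 : ∀ k i : Fin d, q ≤ (k:ℕ) → (i:ℕ) < q →
      (EuclideanSpace.single i 1 : EuclideanSpace ℝ (Fin d)) k = 0 := by
    intro k i hk hi
    have : k ≠ i := by
      rintro rfl
      omega
    simp [this]
  have h1 := hdir ((1/2:ℝ) • (EuclideanSpace.single i 1 + EuclideanSpace.single j 1)) (by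
    rw [norm_smul]
    have := norm_add_le (EuclideanSpace.single i 1 : EuclideanSpace ℝ (Fin d)) (EuclideanSpace.single j 1)
    rw [hnorm, hnorm] at this
    norm_num
    linarith) (by
    intro k hk
    rw [PiLp.smul_apply, PiLp.add_apply, hz1 k i hk hi, hz1 k j hk hj]
    simp)
  have h2 := hdir ((1/2:ℝ) • (EuclideanSpace.single i 1 - EuclideanSpace.single j 1)) (by
    rw [norm_smul]
    have := norm_sub_le (EuclideanSpace.single i 1 : EuclideanSpace ℝ (Fin d)) (EuclideanSpace.single j 1)
    rw [hnorm, hnorm] at this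
    norm_num
    linarith) (by
    intro k hk
    rw [PiLp.smul_apply, PiLp.sub_apply, hz1 k i hk hi, hz1 k j hk hj]
    simp)
  rw [hpol x hx1, hpol y hy1]
  rw [abs_le] at h1 h2 ⊢
  constructor <;> linarith [h1.1, h1.2, h2.1, h2.2]

lemma pd2_all (d q : ℕ) {ν δ : ℝ} (hν : 0 < ν) (hδ : 0 < δ) (hδ1 : δ < 1) :
    ∃ N : ℝ, 0 < N ∧
      ∀ u T, GoodS d q ν δ u T → ∀ i j : Fin d, (i:ℕ) < q → (j:ℕ) < q →
        PHolderX d q δ (ball (0 : EuclideanSpace ℝ (Fin d)) (1 / 2)) (pd2 i j u) (N * T) := by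
  obtain ⟨h0, C, hh0, hC, H⟩ := pd2_close d q hν hδ hδ1
  obtain ⟨n, hn⟩ := exists_nat_one_div_lt hh0
  refine ⟨((n:ℝ) + 1) * C, by positivity, ?_⟩
  intro u T hg i j hi hj x hx y hy hxy
  have hT := hg.pos
  have hn0 : (0:ℝ) < n + 1 := by positivity
  have hdist : dist x y < 1 := by
    have h1 := dist_triangle_right x y 0
    rw [mem_ball] at hx hy
    linarith
  set P : ℕ → EuclideanSpace ℝ (Fin d) := fun k => x + ((k:ℝ) / (n + 1)) • (y - x) with hP
  have hPmem : ∀ k ≤ n + 1, P k ∈ ball (0 : EuclideanSpace ℝ (Fin d)) (1 / 2) := by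
    intro k hk
    apply (convex_ball (0 : EuclideanSpace ℝ (Fin d)) (1/2)).add_smul_sub_mem hx hy
    refine ⟨by positivity, ?_⟩
    rw [div_le_one hn0]
    exact_mod_cast hk
  have hPd : ∀ k, dist (P k) (P (k + 1)) = dist x y / (n + 1) := by
    intro k
    have : P k - P (k + 1) = ((1:ℝ) / (n + 1)) • (x - y) := by
      simp only [hP]
      push_cast
      rw [add_div]
      module
    rw [dist_eq_norm, this, norm_smul, Real.norm_eq_abs, abs_of_pos (by positivity), dist_eq_norm]
    ring
  have hPs : ∀ k, ∀ l : Fin d, q ≤ (l:ℕ) → P k l = x l := by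
    intro k l hl
    simp [hP, hxy l hl]
  have hstep : ∀ k < n + 1, dist (pd2 i j u (P k)) (pd2 i j u (P (k + 1))) ≤ C * T * dist x y ^ δ := by
    intro k hk
    rw [Real.dist_eq]
    have hlt : dist (P k) (P (k + 1)) ≤ dist x y := by
      rw [hPd]
      exact div_le_self dist_nonneg (by linarith [(Nat.cast_nonneg n : (0:ℝ) ≤ n)])
    refine (H u T hg i j hi hj _ (hPmem k hk.le) _ (hPmem (k + 1) hk) (fun l hl => by
      rw [hPs k l hl, hPs (k + 1) l hl]) ?_).trans ?_
    · rw [hPd]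
      refine lt_trans ?_ hn
      gcongr
    · have := Real.rpow_le_rpow dist_nonneg hlt hδ.le
      gcongr
  have hsum := dist_le_range_sum_of_dist_le (f := fun k => pd2 i j u (P k)) (n + 1)
    (d := fun _ => C * T * dist x y ^ δ) (fun {k} hk => hstep k hk)
  have hP0 : P 0 = x := by simp [hP]
  have hPn : P (n + 1) = y := by
    simp only [hP]
    push_cast
    rw [div_self hn0.ne', one_smul]
    abel
  rw [hP0, hPn, Real.dist_eq] at hsum
  refine hsum.trans (le_of_eq ?_)
  simp
  ring

/-- **Theorem 2.1 (ii)**: interior partial Schauder estimate on the unit ball for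
non-divergence form elliptic equations with coefficients independent of `x'`. -/
theorem partial_schauder_elliptic_ball
    (d q : ℕ) (ν δ : ℝ) (hd : 2 ≤ d) (hq1 : 1 ≤ q) (hqd : q < d)
    (hν : ν ∈ Ioc (0 : ℝ) 1) (hδ : δ ∈ Ioo (0 : ℝ) 1) :
    ∃ N : ℝ, 0 < N ∧
      ∀ (a : Fin d → Fin d → EuclideanSpace ℝ (Fin d) → ℝ)
        (u f : EuclideanSpace ℝ (Fin d) → ℝ),
        (∀ i j, Measurable (a i j)) →
        (∀ i j x, a i j x = a j i x) →
        UnifElliptic d ν a →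
        (∀ i j (x y : EuclideanSpace ℝ (Fin d)),
          (∀ k : Fin d, q ≤ (k : ℕ) → x k = y k) → a i j x = a i j y) →
        ContDiffOn ℝ 2 u (ball (0 : EuclideanSpace ℝ (Fin d)) 1) →
        (∀ᵐ x ∂(volume.restrict (ball (0 : EuclideanSpace ℝ (Fin d)) 1)),
          ∑ i, ∑ j, a i j x * pd2 i j u x = f x) →
        ∀ K M : ℝ, 0 ≤ K →
          PHolderX d q δ (ball (0 : EuclideanSpace ℝ (Fin d)) 1) f K →
          (∀ x ∈ ball (0 : EuclideanSpace ℝ (Fin d)) 1, |u x| ≤ M) →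
          ∀ i j : Fin d, (i : ℕ) < q → (j : ℕ) < q →
            PHolderX d q δ (ball (0 : EuclideanSpace ℝ (Fin d)) (1/2))
              (pd2 i j u) (N * (K + M)) := by
  obtain ⟨N, hN, H⟩ := pd2_all d q hν.1 hδ.1 hδ.2
  refine ⟨N, hN, ?_⟩
  intro a u f _ hsymm hell hind hu heq K M hK hf hM i j hi hj x hx y hy hxy
  have hM0 : 0 ≤ M := (abs_nonneg _).trans (hM 0 (by simp))
  have key : ∀ η > 0, |pd2 i j u x - pd2 i j u y| ≤ N * (K + M + η) * dist x y ^ δ := by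
    intro η hη
    have hg : GoodS d q ν δ u (K + M + η) :=
      goodS_of hν.1 hδ.1 a u f hsymm hell hind hu heq hf hM (by linarith) (by linarith) (by linarith)
    exact H u _ hg i j hi hj x hx y hy hxy
  have hlim : Tendsto (fun η : ℝ => N * (K + M + η) * dist x y ^ δ) (nhdsWithin 0 (Ioi 0))
      (nhds (N * (K + M + 0) * dist x y ^ δ)) := by
    have hc : Continuous (fun η : ℝ => N * (K + M + η) * dist x y ^ δ) := by fun_prop
    exact (hc.tendsto 0).mono_left nhdsWithin_le_nhds
  rw [add_zero] at hlim
  refine ge_of_tendsto hlim ?_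
  filter_upwards [self_mem_nhdsWithin] with η hη using key η hη
end
end
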